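/- arXiv:1709.02107 — 2 statements merged into one kernel-verified Lean document; each statement's English description precedes it below -/
import Mathlib

section
/- For every CGS G, state s, set of agents A, and ATL* path formula φ: G, s ⊨ [[A]]φ (where [[A]]φ := ¬⟨⟨A⟩⟩¬φ) if and only if there exists a counter strategy f^c_A for A such that G, π ⊨ φ for all plays π ∈ out(s, f^c_A). -/
open scoped Classical

/-- A concurrent game structure over atomic propositions `AP`, agents `Ag`,
actions `Ac` and states `S`.  `tau s d = none` models the undefined value ⊤. -/
structure CGS (AP Ag Ac S : Type) where
  init : S
  lab : S → Set AP
  tau : S → (Ag → Ac) → Option S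
  total : ∀ s : S, ∃ d : Ag → Ac, (tau s d).isSome

namespace CGS

variable {AP Ag Ac S : Type}

/-- Combine an `A`-decision with a decision of the remaining agents. -/
noncomputable def combine (A : Set Ag) (dA : A → Ac) (d' : Ag → Ac) : Ag → Ac :=
  fun a => if h : a ∈ A then dA ⟨a, h⟩ else d' a

/-- The `A`-decision `dA` is available at state `s`. -/
def Avail (G : CGS AP Ag Ac S) (A : Set Ag) (s : S) (dA : A → Ac) : Prop :=
  ∃ d' : Ag → Ac, (G.tau s (combine A dA d')).isSome

/-- Successor relation between states. -/
def Succ (G : CGS AP Ag Ac S) (s s' : S) : Prop := ∃ d, G.tau s d = some s'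

/-- An (infinite) play. -/
def IsPlay (G : CGS AP Ag Ac S) (π : ℕ → S) : Prop := ∀ i, Succ G (π i) (π (i + 1))

/-- Last state of a track (`init` as a junk default for the empty list). -/
def lst (G : CGS AP Ag Ac S) (ν : List S) : S := ν.getLastD G.init

/-- The finite track consisting of the first `i+1` states of `π`. -/
def trk (π : ℕ → S) (i : ℕ) : List S := List.ofFn fun j : Fin (i + 1) => π j

/-- A strategy for coalition `A` assigns to every (nonempty) track an
available `A`-decision at its last state. -/
def StratOK (G : CGS AP Ag Ac S) (A : Set Ag) (f : List S → (A → Ac)) : Prop :=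
  ∀ ν : List S, ν ≠ [] → G.Avail A (G.lst ν) (f ν)

/-- The plays from `s` consistent with the strategy `f` of coalition `A`. -/
def Outcome (G : CGS AP Ag Ac S) (A : Set Ag) (f : List S → (A → Ac)) (s : S)
    (π : ℕ → S) : Prop :=
  π 0 = s ∧ ∀ i, ∃ d' : Ag → Ac,
    G.tau (π i) (combine A (f (trk π i)) d') = some (π (i + 1))

/-- A counter strategy for coalition `A`. -/
def CStratOK (G : CGS AP Ag Ac S) (A : Set Ag)
    (fc : List S → (A → Ac) → (Ag → Ac)) : Prop :=
  ∀ ν : List S, ν ≠ [] → ∀ dA : A → Ac, G.Avail A (G.lst ν) dA →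
    (G.tau (G.lst ν) (combine A dA (fc ν dA))).isSome

/-- The plays from `s` consistent with the counter strategy `fc` for `A`. -/
def COutcome (G : CGS AP Ag Ac S) (A : Set Ag)
    (fc : List S → (A → Ac) → (Ag → Ac)) (s : S) (π : ℕ → S) : Prop :=
  π 0 = s ∧ ∀ i, ∃ dA : A → Ac, G.Avail A (π i) dA ∧
    G.tau (π i) (combine A dA (fc (trk π i) dA)) = some (π (i + 1))

/-- Shift of an infinite sequence. -/
def shift (π : ℕ → S) (k : ℕ) : ℕ → S := fun i => π (i + k)

end CGS

/-- Syntax of ATL*. -/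
inductive ATLs (AP Ag : Type) : Type
  | tt : ATLs AP Ag
  | atom : AP → ATLs AP Ag
  | neg : ATLs AP Ag → ATLs AP Ag
  | or : ATLs AP Ag → ATLs AP Ag → ATLs AP Ag
  | next : ATLs AP Ag → ATLs AP Ag
  | untl : ATLs AP Ag → ATLs AP Ag → ATLs AP Ag
  | coal : Set Ag → ATLs AP Ag → ATLs AP Ag

namespace ATLs

variable {AP Ag Ac S : Type}

/-- Satisfaction `G, π ⊨ φ` of an ATL* formula along a play. -/
def sat (G : CGS AP Ag Ac S) : ATLs AP Ag → (ℕ → S) → Prop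
  | tt, _ => True
  | atom p, π => p ∈ G.lab (π 0)
  | neg φ, π => ¬ sat G φ π
  | or φ ψ, π => sat G φ π ∨ sat G ψ π
  | next φ, π => sat G φ (CGS.shift π 1)
  | untl φ ψ, π => ∃ j : ℕ, sat G ψ (CGS.shift π j) ∧
      ∀ k < j, sat G φ (CGS.shift π k)
  | coal A φ, π => ∃ f : List S → (A → Ac), CGS.StratOK G A f ∧
      ∀ π' : ℕ → S, CGS.Outcome G A f (π 0) π' → sat G φ π'

/-- `G, s ⊨ φ` : there is a play from `s` satisfying `φ`. -/
def satState (G : CGS AP Ag Ac S) (s : S) (φ : ATLs AP Ag) : Prop :=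
  ∃ π : ℕ → S, CGS.IsPlay G π ∧ π 0 = s ∧ sat G φ π

/-- `G ⊨ φ`. -/
def models (G : CGS AP Ag Ac S) (φ : ATLs AP Ag) : Prop := satState G G.init φ

/-- State formulas: every temporal modality is under a strategic quantifier. -/
inductive IsState : ATLs AP Ag → Prop
  | tt : IsState tt
  | atom (p : AP) : IsState (atom p)
  | neg {φ} : IsState φ → IsState (neg φ)
  | or {φ ψ} : IsState φ → IsState ψ → IsState (or φ ψ)
  | coal (A : Set Ag) (φ : ATLs AP Ag) : IsState (coal A φ)

end ATLs


namespace Duality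

/-- Reversed track of the first `n+1` states of `w`. -/
def rtrk {S : Type} (w : ℕ → S) : ℕ → List S
  | 0 => [w 0]
  | n + 1 => w (n + 1) :: rtrk w n

theorem rtrk_length {S : Type} (w : ℕ → S) (n : ℕ) : (rtrk w n).length = n + 1 := by
  induction n with
  | zero => rfl
  | succ n ih => simp [rtrk, ih]

theorem rtrk_agree {S : Type} {w w' : ℕ → S} {n : ℕ} (h : rtrk w n = rtrk w' n) :
    ∀ i ≤ n, w i = w' i := by
  induction n with
  | zero =>
    intro i hi
    obtain rfl : i = 0 := by omega
    simpa [rtrk] using h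
  | succ n ih =>
    simp only [rtrk, List.cons.injEq] at h
    intro i hi
    rcases Nat.lt_or_ge n i with h1 | h1
    · obtain rfl : i = n + 1 := by omega
      exact h.1
    · exact ih h.2 i h1

theorem rtrk_congr {S : Type} {w w' : ℕ → S} {n : ℕ} (h : ∀ i ≤ n, w i = w' i) :
    rtrk w n = rtrk w' n := by
  induction n with
  | zero => simp [rtrk, h 0 le_rfl]
  | succ n ih => simp [rtrk, h (n+1) le_rfl, ih (fun i hi => h i (by omega))]

theorem rtrk_idx {S : Type} {w w' : ℕ → S} {n m : ℕ} (h : rtrk w n = rtrk w' m) : n = m := by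
  have := congrArg List.length h
  simpa [rtrk_length] using this

/-- Memory along a reversed track, started at `p` with value `m0`. -/
noncomputable def memo {S Mem : Type} (p : List S) (m0 : Mem) (upd : Mem → List S → Mem) :
    List S → Mem
  | [] => m0
  | s :: q => if s :: q = p then m0 else upd (memo p m0 upd q) (s :: q)

theorem memo_start {S Mem : Type} (p : List S) (m0 : Mem) (upd : Mem → List S → Mem) :
    memo p m0 upd p = m0 := by
  cases p <;> simp [memo]

theorem memo_succ {S Mem : Type} (p : List S) (m0 : Mem) (upd : Mem → List S → Mem)
    (w : ℕ → S) (n m : ℕ) (hp : rtrk w n = p) (hm : n ≤ m) :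
    memo p m0 upd (rtrk w (m+1)) = upd (memo p m0 upd (rtrk w m)) (rtrk w (m+1)) := by
  have : rtrk w (m+1) ≠ p := by
    rw [← hp]; intro h; have := rtrk_idx h; omega
  conv_lhs => rw [rtrk, memo]
  rw [if_neg (by simpa [rtrk] using this)]
  rfl

section Game

variable {S : Type} (M : List S → Set (Set S))

/-- Player I wins from `p` for payoff `X`, when II is restricted to `W`. -/
def Win (W : Set (List S)) (p : List S) (X : Set (ℕ → S)) : Prop :=
  ∃ f : List S → Set S, (∀ q, f q ∈ M q) ∧ ∀ w n, rtrk w n = p →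
    (∀ m, n ≤ m → w (m+1) ∈ f (rtrk w m) ∧ rtrk w (m+1) ∈ W) → w ∈ X

theorem glue {W : Set (List S)} {p : List S} {X : Set (ℕ → S)} (E : Set (List S))
    (f : List S → Set S) (hf : ∀ q, f q ∈ M q)
    (hE : ∀ e ∈ E, Win M W e X)
    (h : ∀ w n, rtrk w n = p →
      (∀ m, n ≤ m → w (m+1) ∈ f (rtrk w m) ∧ rtrk w (m+1) ∈ W) →
      (∀ m, n < m → rtrk w m ∉ E) → w ∈ X) : Win M W p X := by
  choose! g hg1 hg2 using hE
  let F : Option (List S) → List S → Set S := fun o => match o with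
    | none => f
    | some e => if e ∈ E then g e else f
  let upd : Option (List S) → List S → Option (List S) := fun o q => match o with
    | none => if q ∈ E then some q else none
    | some e => some e
  refine ⟨fun q => F (memo p none upd q) q, ?_, ?_⟩
  · intro q
    beta_reduce
    rcases memo p none upd q with _ | e
    · exact hf q
    · by_cases he : e ∈ E
      · simp only [F, if_pos he]; exact hg1 e he q
      · simp only [F, if_neg he]; exact hf q
  · intro w n hw hc
    beta_reduce at hc
    have h0 : memo p none upd (rtrk w n) = none := by rw [hw]; exact memo_start _ _ _
    have hs := fun m hm => memo_succ p none upd w n m hw hm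
    by_cases hex : ∃ m, n < m ∧ rtrk w m ∈ E
    · obtain ⟨hm1, hm2⟩ := Nat.find_spec hex
      have hmin := fun k => Nat.find_min hex (m := k)
      generalize Nat.find hex = m at hm1 hm2 hmin
      have hnone : ∀ k, n + k < m → memo p none upd (rtrk w (n+k)) = none := by
        intro k
        induction k with
        | zero => intro _; exact h0
        | succ k ih =>
          intro hk
          rw [← Nat.add_assoc, hs _ (by omega), ih (by omega)]
          have := hmin (n+k+1) (by omega)
          simp only [upd]
          rw [if_neg]
          intro hh; exact this ⟨by omega, hh⟩
      have hsome : ∀ k, memo p none upd (rtrk w (m+k)) = some (rtrk w m) := by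
        intro k
        induction k with
        | zero =>
          obtain ⟨j, hj⟩ : ∃ j, m = n + j + 1 := ⟨m - n - 1, by omega⟩
          have h1 := hs (n+j) (by omega)
          rw [hnone j (by omega), ← hj] at h1
          rw [Nat.add_zero, h1]
          simp only [upd, if_pos hm2]
        | succ k ih => rw [← Nat.add_assoc, hs _ (by omega), ih]
      apply hg2 _ hm2 w m rfl
      intro k hk
      obtain ⟨j, rfl⟩ := Nat.exists_eq_add_of_le hk
      have := hc (m+j) (by omega)
      rw [hsome j] at this
      simpa only [F, if_pos hm2] using this
    · push Not at hex
      have hnone : ∀ k, memo p none upd (rtrk w (n+k)) = none := by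
        intro k
        induction k with
        | zero => exact h0
        | succ k ih =>
          rw [← Nat.add_assoc, hs _ (by omega), ih]
          simp only [upd, if_neg (hex (n+k+1) (by omega))]
      refine h w n hw ?_ hex
      intro m hm
      obtain ⟨j, rfl⟩ := Nat.exists_eq_add_of_le hm
      have := hc (n+j) hm
      rwa [hnone j] at this

/-- Non-losing positions for II. -/
def NL (W : Set (List S)) (X : Set (ℕ → S)) : Set (List S) := {q | q ∈ W ∧ ¬ Win M W q X}

theorem NL_step (hM : ∀ q, (M q).Nonempty) {W : Set (List S)} {X : Set (ℕ → S)} {q : List S}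
    (hq : q ∈ NL M W X) {U : Set S} (hU : U ∈ M q) : ∃ s ∈ U, s :: q ∈ NL M W X := by
  by_contra hcon
  push Not at hcon
  apply hq.2
  choose f0 hf0 using hM
  refine glue M {e | e ∈ W ∧ Win M W e X} (fun q' => if q' = q then U else f0 q') ?_ ?_ ?_
  · intro q'
    by_cases h : q' = q
    · subst h; simpa using hU
    · simpa [h] using hf0 q'
  · intro e he; exact he.2
  · intro w n hw hc hE
    exfalso
    obtain ⟨h1, h2⟩ := hc n le_rfl
    rw [hw] at h1
    simp only [if_true] at h1
    apply hcon _ h1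
    have h3 : rtrk w (n+1) = w (n+1) :: q := by rw [rtrk, hw]
    rw [← h3]
    exact ⟨h2, fun hw' => hE (n+1) (by omega) ⟨h2, hw'⟩⟩

theorem NL_NL {W : Set (List S)} {X : Set (ℕ → S)} {q : List S}
    (hq : q ∈ NL M W X) : ¬ Win M (NL M W X) q X := by
  rintro ⟨f, hf, h⟩
  apply hq.2
  refine glue M {e | e ∈ W ∧ Win M W e X} f hf (fun e he => he.2) ?_
  intro w n hw hc hE
  refine h w n hw fun m hm => ⟨(hc m hm).1, (hc m hm).2, fun h' => ?_⟩
  exact hE (m+1) (by omega) ⟨(hc m hm).2, h'⟩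

/-- Good positions in the sense of Davis. -/
def Good (T : Set (List S)) (A B : Set (ℕ → S)) (W : Set (List S)) (p : List S) : Prop :=
  W ⊆ T ∧ p ∈ W ∧ ¬ Win M W p A ∧
    ∀ w n, rtrk w n = p → (∀ m, n ≤ m → rtrk w m ∈ W) → w ∉ B

theorem davis_step1 (hM : ∀ q, (M q).Nonempty) (T : Set (List S)) (A B : Set (ℕ → S))
    (D : List S → Prop) (hD : ∀ w ∈ B, ∀ n, ∃ m, n ≤ m ∧ D (rtrk w m)) (e : List S) (heT : e ∈ T)
    (hng : ¬ ∃ W, Good M T A B W e) :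
    Win M T e (A ∪ {w | ∃ m, e.length ≤ m ∧ D (rtrk w m) ∧ ¬ ∃ W, Good M T A B W (rtrk w m)}) := by
  set X := A ∪ {w | ∃ m, e.length ≤ m ∧ D (rtrk w m) ∧ ¬ ∃ W, Good M T A B W (rtrk w m)} with hX
  by_contra hnw
  apply hng
  have heNL : e ∈ NL M T X := ⟨heT, hnw⟩
  let trig : List S → Prop := fun q => D q ∧ ∃ W, Good M T A B W q
  have hgood : ∀ w m, e.length ≤ m → rtrk w m ∈ NL M T X → D (rtrk w m) → trig (rtrk w m) := by
    intro w m hm hq hd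
    refine ⟨hd, ?_⟩
    by_contra hg
    apply hq.2
    choose f0 hf0 using hM
    refine ⟨f0, hf0, fun w' n' hw' _ => Or.inr ⟨m, hm, ?_⟩⟩
    obtain rfl := rtrk_idx hw'
    rw [hw']
    exact ⟨hd, hg⟩
  let WW : List S → Set (List S) := fun q => if h : ∃ W, Good M T A B W q then h.choose else ∅
  have hWW : ∀ q, trig q → Good M T A B (WW q) q := by
    intro q hq
    simp only [WW, dif_pos hq.2]
    exact hq.2.choose_spec
  have hWWT : ∀ q, WW q ⊆ T := by
    intro q
    by_cases h : ∃ W, Good M T A B W q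
    · simp only [WW, dif_pos h]; exact h.choose_spec.1
    · simp only [WW, dif_neg h]; exact Set.empty_subset _
  let upd : Option (List S) → List S → Option (List S) := fun o q => match o with
    | none => if trig q then some q else none
    | some e => some e
  let tr : Option (List S) → Set (List S) := fun o => match o with
    | none => NL M T X
    | some q => WW q
  let W : Set (List S) := {q | q ∈ tr (memo e none upd q)}
  have hW : ∀ q, q ∈ W ↔ q ∈ tr (memo e none upd q) := fun q => Iff.rfl
  have hnone : ∀ w n, rtrk w n = e → ∀ m, n ≤ m → (∀ k, n < k → k ≤ m → ¬ trig (rtrk w k)) →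
      memo e none upd (rtrk w m) = none := by
    intro w n hw m hm
    induction m, hm using Nat.le_induction with
    | base => intro _; rw [hw]; exact memo_start _ _ _
    | succ m hm ih =>
      intro hk
      rw [memo_succ e none upd w n m hw hm, ih (fun k h1 h2 => hk k h1 (by omega))]
      simp only [upd, if_neg (hk (m+1) (by omega) le_rfl)]
  have hsome : ∀ w n, rtrk w n = e → ∀ m, n < m → (∀ k, n < k → k < m → ¬ trig (rtrk w k)) →
      trig (rtrk w m) → ∀ k, m ≤ k → memo e none upd (rtrk w k) = some (rtrk w m) := by
    intro w n hw m hm hk ht k hmk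
    induction k, hmk using Nat.le_induction with
    | base =>
      obtain ⟨j, rfl⟩ : ∃ j, m = j + 1 := ⟨m - 1, by omega⟩
      rw [memo_succ e none upd w n j hw (by omega),
        hnone w n hw j (by omega) (fun k h1 h2 => hk k h1 (by omega))]
      simp only [upd, if_pos ht]
    | succ k hmk ih => rw [memo_succ e none upd w n k hw (by omega), ih]
  refine ⟨W, ?_, ?_, ?_, ?_⟩
  · intro q hq
    rw [hW] at hq
    rcases h : memo e none upd q with _ | q'
    · rw [h] at hq; exact hq.1
    · rw [h] at hq; exact hWWT _ hq
  · rw [hW, memo_start]; exact heNL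
  · rintro ⟨f, hf, hwin⟩
    apply hnw
    refine glue M {q | q ∈ T ∧ Win M T q X} f hf (fun e he => he.2) ?_
    intro w n hw hc hE
    have hin : ∀ m, n ≤ m → rtrk w m ∈ NL M T X := by
      intro m hm
      rcases Nat.eq_or_lt_of_le hm with rfl | hlt
      · rw [hw]; exact heNL
      · obtain ⟨j, rfl⟩ : ∃ j, m = j + 1 := ⟨m - 1, by omega⟩
        have hT := (hc j (by omega)).2
        exact ⟨hT, fun h' => hE (j+1) hlt ⟨hT, h'⟩⟩
    by_cases hex : ∃ m, n < m ∧ trig (rtrk w m)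
    · exfalso
      obtain ⟨hm1, hm2⟩ := Nat.find_spec hex
      have hmin := fun k => Nat.find_min hex (m := k)
      generalize Nat.find hex = m at hm1 hm2 hmin
      apply (hWW _ hm2).2.2.1
      refine ⟨f, hf, ?_⟩
      intro w' n' hw' hc'
      obtain rfl := rtrk_idx hw'
      have hag := rtrk_agree hw'
      have hagr : ∀ k, k ≤ n' → rtrk w' k = rtrk w k := fun k hk =>
        rtrk_congr (fun i hi => hag i (by omega))
      have hw'e : rtrk w' n = e := by rw [hagr n (by omega), hw]
      have hnt : ∀ k, n < k → k < n' → ¬ trig (rtrk w' k) := by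
        intro k h1 h2 h3
        rw [hagr k (by omega)] at h3
        exact hmin k h2 ⟨h1, h3⟩
      have ht : trig (rtrk w' n') := by rw [hw']; exact hm2
      apply hwin w' n hw'e
      intro k hk
      rcases Nat.lt_or_ge k n' with hlt | hge
      · constructor
        · rw [hagr k (by omega), hag (k+1) (by omega)]; exact (hc k hk).1
        · rw [hW]
          rcases Nat.eq_or_lt_of_le (show k + 1 ≤ n' from hlt) with heq | hlt'
          · rw [hsome w' n hw'e n' hm1 hnt ht (k+1) (by omega), heq]
            exact (hWW _ ht).2.1
          · rw [hnone w' n hw'e (k+1) (by omega) (fun j h1 h2 => hnt j h1 (by omega)),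
              hagr (k+1) (by omega)]
            exact hin (k+1) (by omega)
      · refine ⟨(hc' k hge).1, ?_⟩
        rw [hW, hsome w' n hw'e n' hm1 hnt ht (k+1) (by omega), hw']
        exact (hc' k hge).2
    · push Not at hex
      left
      apply hwin w n hw
      intro m hm
      refine ⟨(hc m hm).1, ?_⟩
      rw [hW, hnone w n hw (m+1) (by omega) (fun k h1 _ => hex k h1)]
      exact hin (m+1) (by omega)
  · intro w n hw hin hB
    by_cases hex : ∃ m, n < m ∧ trig (rtrk w m)
    · obtain ⟨hm1, hm2⟩ := Nat.find_spec hex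
      have hmin := fun k => Nat.find_min hex (m := k)
      generalize Nat.find hex = m at hm1 hm2 hmin
      refine (hWW _ hm2).2.2.2 w m rfl ?_ hB
      intro k hk
      have := hin k (by omega)
      rw [hW, hsome w n hw m hm1 (fun k h1 h2 h3 => hmin k h2 ⟨h1, h3⟩) hm2 k hk] at this
      exact this
    · push Not at hex
      obtain ⟨m, hm, hd⟩ := hD w hB (n+1)
      apply hex m (by omega)
      refine hgood w m ?_ ?_ hd
      · rw [← hw, rtrk_length]; exact hm
      · have := hin m (by omega)
        rw [hW, hnone w n hw m (by omega) (fun k h1 _ => hex k h1)] at this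
        exact this

theorem davis (hM : ∀ q, (M q).Nonempty) (T : Set (List S)) (A B : Set (ℕ → S)) (hBA : B ⊆ A)
    (D : ℕ → List S → Prop) (hmono : ∀ k s q, D k q → D k (s :: q))
    (hB : ∀ w, w ∈ B ↔ ∀ k, ∃ m, D k (rtrk w m)) (p : List S) (hpT : p ∈ T)
    (hnw : ¬ Win M T p A) : ∃ W, Good M T A B W p := by
  by_contra hng
  apply hnw
  have hup : ∀ k w m j, D k (rtrk w m) → D k (rtrk w (m+j)) := by
    intro k w m j h
    induction j with
    | zero => exact h
    | succ j ih => exact hmono _ _ _ ih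
  have hS : ∀ k e, e ∈ T ∧ (¬ ∃ W, Good M T A B W e) → Win M T e
      (A ∪ {w | ∃ m, e.length ≤ m ∧ D k (rtrk w m) ∧ ¬ ∃ W, Good M T A B W (rtrk w m)}) := by
    rintro k e ⟨h1, h2⟩
    refine davis_step1 M hM T A B (D k) ?_ e h1 h2
    intro w hw n
    obtain ⟨m, hm⟩ := (hB w).1 hw k
    exact ⟨m + n, by omega, hup k w m n hm⟩
  choose! g hg1 hg2 using hS
  choose f0 hf0 using hM
  let F : ℕ × List S → List S → Set S := fun c =>
    if c.2 ∈ T ∧ (¬ ∃ W, Good M T A B W c.2) then g c.1 c.2 else f0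
  let sw : ℕ × List S → List S → Prop := fun c q => D c.1 q ∧ ¬ ∃ W, Good M T A B W q
  let upd : ℕ × List S → List S → ℕ × List S := fun c q => if sw c q then (c.1 + 1, q) else c
  refine ⟨fun q => F (memo p (0, p) upd q) q, ?_, ?_⟩
  · intro q
    beta_reduce
    generalize memo p (0, p) upd q = c
    by_cases hc : c.2 ∈ T ∧ (¬ ∃ W, Good M T A B W c.2)
    · simp only [F, if_pos hc]; exact hg1 _ _ hc q
    · simp only [F, if_neg hc]; exact hf0 q
  · intro w n hw hc
    beta_reduce at hc
    set μ : ℕ → ℕ × List S := fun m => memo p (0, p) upd (rtrk w m) with hμ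
    have hμ0 : μ n = (0, p) := by simp only [hμ, hw]; exact memo_start _ _ _
    have hμs : ∀ m, n ≤ m → μ (m+1) = upd (μ m) (rtrk w (m+1)) := fun m hm =>
      memo_succ p (0, p) upd w n m hw hm
    have hinT : ∀ m, n ≤ m → rtrk w m ∈ T := by
      intro m hm
      rcases Nat.eq_or_lt_of_le hm with rfl | hlt
      · rw [hw]; exact hpT
      · obtain ⟨j, rfl⟩ : ∃ j, m = j + 1 := ⟨m - 1, by omega⟩
        exact (hc j (by omega)).2
    have hinv : ∀ m, n ≤ m → ∃ i, n ≤ i ∧ i ≤ m ∧ rtrk w i = (μ m).2 ∧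
        (¬ ∃ W, Good M T A B W (μ m).2) ∧ ∀ j, i ≤ j → j ≤ m → μ j = μ m := by
      intro m hm
      induction m, hm using Nat.le_induction with
      | base =>
        refine ⟨n, le_rfl, le_rfl, by rw [hμ0, hw], by rw [hμ0]; exact hng, ?_⟩
        intro j h1 h2
        rw [le_antisymm h1 h2]
      | succ m hm ih =>
        by_cases hsw : sw (μ m) (rtrk w (m+1))
        · have h1 := hμs m hm
          simp only [upd, if_pos hsw] at h1
          refine ⟨m+1, by omega, le_rfl, by rw [h1], by rw [h1]; exact hsw.2, ?_⟩
          intro j h1 h2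
          rw [le_antisymm h1 h2]
        · have h1 := hμs m hm
          simp only [upd, if_neg hsw] at h1
          obtain ⟨i, a, b, c, d, e⟩ := ih
          rw [h1]
          refine ⟨i, a, by omega, c, d, ?_⟩
          intro j h2 h3
          rcases Nat.eq_or_lt_of_le h3 with rfl | h4
          · exact h1
          · exact e j h2 (by omega)
    have hconst : ∀ m m', n ≤ m → m ≤ m' → (∀ j, m ≤ j → j < m' → ¬ sw (μ j) (rtrk w (j+1))) →
        μ m' = μ m := by
      intro m m' hm hmm
      induction m', hmm using Nat.le_induction with
      | base => intro _; rfl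
      | succ k hk ih =>
        intro h
        have h1 := hμs k (by omega)
        simp only [upd, if_neg (h k hk (by omega))] at h1
        rw [h1]
        exact ih (fun j h1 h2 => h j h1 (by omega))
    by_cases hinf : ∀ m, n ≤ m → ∃ m', m ≤ m' ∧ sw (μ m') (rtrk w (m'+1))
    · apply hBA
      rw [hB]
      have key : ∀ m, n ≤ m → ∃ m', m ≤ m' ∧ D (μ m).1 (rtrk w (m'+1)) ∧
          (μ (m'+1)).1 = (μ m).1 + 1 := by
        intro m hm
        have hex := hinf m hm
        obtain ⟨h1, h2⟩ := Nat.find_spec hex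
        have hmin := fun k => Nat.find_min hex (m := k)
        set m' := Nat.find hex
        have h3 : μ m' = μ m := hconst m m' hm h1 (fun j ha hb hs => hmin j hb ⟨ha, hs⟩)
        refine ⟨m', h1, by rw [← h3]; exact h2.1, ?_⟩
        rw [hμs m' (by omega)]
        simp only [upd, if_pos h2]
        rw [h3]
      have key2 : ∀ k, ∃ m, n ≤ m ∧ (μ m).1 = k := by
        intro k
        induction k with
        | zero => exact ⟨n, le_rfl, by rw [hμ0]⟩
        | succ k ih =>
          obtain ⟨m, hm, rfl⟩ := ih
          obtain ⟨m', a, _, c⟩ := key m hm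
          exact ⟨m'+1, by omega, c⟩
      intro k
      obtain ⟨m, hm, rfl⟩ := key2 k
      obtain ⟨m', a, b, _⟩ := key m hm
      exact ⟨_, b⟩
    · push Not at hinf
      obtain ⟨m, hm, hns⟩ := hinf
      obtain ⟨i, hi1, hi2, hi3, hi4, hi5⟩ := hinv m hm
      have hall : ∀ j, i ≤ j → μ j = μ m := by
        intro j hj
        rcases le_total j m with h | h
        · exact hi5 j hj h
        · exact hconst m j hm h (fun k h1 _ => hns k h1)
      have hnsw : ∀ j, i ≤ j → ¬ sw (μ j) (rtrk w (j+1)) := by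
        intro j hj hs
        have h1 := hμs j (by omega)
        simp only [upd, if_pos hs] at h1
        rw [hall j hj, hall (j+1) (by omega)] at h1
        have := congrArg Prod.fst h1
        simp at this
      have hcond : (μ m).2 ∈ T ∧ (¬ ∃ W, Good M T A B W (μ m).2) :=
        ⟨by rw [← hi3]; exact hinT i hi1, hi4⟩
      rcases hg2 (μ m).1 (μ m).2 hcond w i hi3 (by
        intro j hj
        have h1 := hc j (by omega)
        have h2 : memo p (0, p) upd (rtrk w j) = μ m := hall j hj
        rw [h2] at h1
        simpa only [F, if_pos hcond] using h1) with hA | ⟨j, hj1, hj2⟩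
      · exact hA
      · exfalso
        rw [← hi3, rtrk_length] at hj1
        obtain ⟨j', rfl⟩ : ∃ j', j = j' + 1 := ⟨j - 1, by omega⟩
        apply hnsw j' (by omega)
        rw [hall j' (by omega)]
        exact hj2

theorem determinacy (hM : ∀ q, (M q).Nonempty) (A : Set (ℕ → S))
    (D : ℕ → ℕ → List S → Prop) (hmono : ∀ n k s q, D n k q → D n k (s :: q))
    (hA : ∀ w, w ∈ A ↔ ∃ n, ∀ k, ∃ m, D n k (rtrk w m)) (p : List S)
    (hnw : ¬ Win M Set.univ p A) :
    ∃ Z : Set (List S), p ∈ Z ∧ (∀ q ∈ Z, ∀ U ∈ M q, ∃ s ∈ U, s :: q ∈ Z) ∧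
      ∀ w n, rtrk w n = p → (∀ m, n ≤ m → rtrk w m ∈ Z) → w ∉ A := by
  let B : ℕ → Set (ℕ → S) := fun n => {w | ∀ k, ∃ m, D n k (rtrk w m)}
  have hBA : ∀ n, B n ⊆ A := fun n w hw => (hA w).2 ⟨n, hw⟩
  have hR : ∀ n W q, q ∈ NL M W A → ∃ W', Good M (NL M W A) A (B n) W' q := by
    intro n W q hq
    exact davis M hM (NL M W A) A (B n) (hBA n) (D n) (hmono n) (fun w => Iff.rfl) q hq
      (NL_NL M hq)
  choose! R hR using hR
  let upd : ℕ × Set (List S) → List S → ℕ × Set (List S) := fun c q => (c.1 + 1, R (c.1+1) c.2 q)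
  let m0 : ℕ × Set (List S) := (0, R 0 Set.univ p)
  let mm := memo p m0 upd
  have hp0 := hR 0 Set.univ p ⟨trivial, hnw⟩
  refine ⟨{q | q ∈ NL M (mm q).2 A ∧ ∀ s q', q = s :: q' → q ≠ p → q ∈ NL M (mm q').2 A},
    ?_, ?_, ?_⟩
  · have : mm p = m0 := memo_start _ _ _
    refine ⟨?_, fun _ _ _ h => absurd rfl h⟩
    rw [this]
    exact ⟨hp0.2.1, hp0.2.2.1⟩
  · rintro q ⟨hq, -⟩ U hU
    obtain ⟨s, hs, hsq⟩ := NL_step M hM hq hU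
    refine ⟨s, hs, ?_, ?_⟩
    · by_cases hsp : s :: q = p
      · have : mm (s :: q) = m0 := by rw [hsp]; exact memo_start _ _ _
        rw [this, hsp]
        exact ⟨hp0.2.1, hp0.2.2.1⟩
      · have : mm (s :: q) = upd (mm q) (s :: q) := by
          simp only [mm]; rw [memo, if_neg hsp]
        rw [this]
        have := hR ((mm q).1 + 1) _ _ hsq
        exact ⟨this.2.1, this.2.2.1⟩
    · intro s' q' h _
      obtain ⟨rfl, rfl⟩ := List.cons.inj h
      exact hsq
  · intro w n hw hin hwA
    have h0 : mm (rtrk w n) = m0 := by rw [hw]; exact memo_start _ _ _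
    have hs : ∀ m, n ≤ m → mm (rtrk w (m+1)) = upd (mm (rtrk w m)) (rtrk w (m+1)) := fun m hm =>
      memo_succ p m0 upd w n m hw hm
    have hstep : ∀ m, n ≤ m → Good M (NL M (mm (rtrk w m)).2 A) A (B ((mm (rtrk w m)).1 + 1))
        (mm (rtrk w (m+1))).2 (rtrk w (m+1)) := by
      intro m hm
      rw [hs m hm]
      apply hR
      refine (hin (m+1) (by omega)).2 _ _ rfl ?_
      intro h
      rw [← hw] at h
      have := rtrk_idx h
      omega
    have hidx : ∀ k, (mm (rtrk w (n+k))).1 = k := by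
      intro k
      induction k with
      | zero => rw [Nat.add_zero, h0]
      | succ k ih => rw [← Nat.add_assoc, hs _ (by omega)]; simp only [upd, ih]
    have hmonoW : ∀ k j, (mm (rtrk w (n+k+j))).2 ⊆ (mm (rtrk w (n+k))).2 := by
      intro k j
      induction j with
      | zero => exact subset_rfl
      | succ j ih => exact fun q hq => ih ((hstep (n+k+j) (by omega)).1 hq).1
    have havoid : ∀ k, ∀ w' n', rtrk w' n' = rtrk w (n+k) →
        (∀ m, n' ≤ m → rtrk w' m ∈ (mm (rtrk w (n+k))).2) → w' ∉ B k := by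
      intro k
      cases k with
      | zero =>
        rw [Nat.add_zero, h0, hw]
        exact hp0.2.2.2
      | succ k =>
        have := (hstep (n+k) (by omega)).2.2.2
        rw [hidx k] at this
        exact this
    obtain ⟨k, hk⟩ := (hA w).1 hwA
    refine havoid k w (n+k) rfl ?_ hk
    intro m hm
    obtain ⟨j, rfl⟩ := Nat.exists_eq_add_of_le hm
    exact hmonoW k j (hin (n+k+j) (by omega)).1.1

end Game

section Automata

open CGS

variable {S : Type}

theorem shift_shift (w : ℕ → S) (a b : ℕ) : shift (shift w a) b = shift w (a + b) := by
  funext i; simp only [shift]; congr 1; omega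

theorem shift_zero (w : ℕ → S) : shift w 0 = w := rfl

/-- Iterated backward transition. -/
def cmp {Q : Type} (T : S → Q → Q) (w : ℕ → S) (n : ℕ) : ℕ → Q → Q
  | 0 => id
  | d + 1 => fun q => cmp T w n d (T (w (n + d)) q)

variable {Q : Type} (T : S → Q → Q)

theorem cmp_add (w : ℕ → S) (n d e : ℕ) (q : Q) :
    cmp T w n (d + e) q = cmp T w n d (cmp T w (n + d) e q) := by
  induction e generalizing q with
  | zero => rfl
  | succ e ih =>
    rw [← Nat.add_assoc]
    simp only [cmp]
    rw [ih, Nat.add_assoc]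

theorem cmp_one (w : ℕ → S) (n : ℕ) (q : Q) : cmp T w n 1 q = T (w n) q := rfl

theorem cmp_shift (w : ℕ → S) (N n d : ℕ) : cmp T (shift w N) n d = cmp T w (N + n) d := by
  induction d with
  | zero => rfl
  | succ d ih =>
    funext q
    simp only [cmp, ih, shift]
    congr 3; omega

theorem cmp_congr {w w' : ℕ → S} {n d : ℕ} (h : ∀ i, i ≤ n + d → w i = w' i) :
    cmp T w n d = cmp T w' n d := by
  induction d with
  | zero => rfl
  | succ d ih =>
    funext q
    simp only [cmp]
    rw [ih (fun i hi => h i (by omega)), h (n + d) (by omega)]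

theorem cmp_V {V : (ℕ → S) → Q} (hV : ∀ w, V w = T (w 0) (V (shift w 1))) (w : ℕ → S) (n d : ℕ) :
    V (shift w n) = cmp T w n d (V (shift w (n + d))) := by
  induction d with
  | zero => rfl
  | succ d ih =>
    rw [ih, hV (shift w (n + d)), shift_shift]
    simp only [cmp, shift, Nat.zero_add, Nat.add_assoc]

/-- The states at `n` admitting arbitrarily long backward histories. -/
def lim (w : ℕ → S) (n : ℕ) : Set Q := ⋂ d, Set.range (cmp T w n d)

theorem range_anti (w : ℕ → S) (n d e : ℕ) :
    Set.range (cmp T w n (d + e)) ⊆ Set.range (cmp T w n d) := by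
  rintro _ ⟨q, rfl⟩
  exact ⟨_, (cmp_add T w n d e q).symm⟩

theorem lim_stab [Finite Q] (w : ℕ → S) (n : ℕ) :
    ∃ d, ∀ e, Set.range (cmp T w n (d + e)) = lim T w n := by
  obtain ⟨x, ⟨d, rfl⟩, hd⟩ := Set.exists_min_image (Set.range fun d => Set.range (cmp T w n d))
    Set.ncard (Set.toFinite _) ⟨_, 0, rfl⟩
  have key : ∀ e, Set.range (cmp T w n (d + e)) = Set.range (cmp T w n d) := by
    intro e
    exact Set.eq_of_subset_of_ncard_le (range_anti T w n d e) (hd _ ⟨d + e, rfl⟩) (Set.toFinite _)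
  refine ⟨d, fun e => ?_⟩
  rw [key e]
  apply Set.Subset.antisymm
  · refine Set.subset_iInter fun e => ?_
    rw [← key e, Nat.add_comm]
    exact range_anti T w n e d
  · exact Set.iInter_subset _ d

theorem lim_image [Finite Q] (w : ℕ → S) (n d : ℕ) :
    cmp T w n d '' lim T w (n + d) = lim T w n := by
  obtain ⟨a, ha⟩ := lim_stab T w (n + d)
  obtain ⟨b, hb⟩ := lim_stab T w n
  rw [← ha b, ← hb (d + a), ← Set.range_comp]
  have : b + (d + a) = d + (a + b) := by omega
  rw [this]
  congr 1
  funext q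
  exact (cmp_add T w n d (a + b) q).symm

theorem lim_card_mono [Finite Q] (w : ℕ → S) (n d : ℕ) :
    (lim T w n).ncard ≤ (lim T w (n + d)).ncard := by
  rw [← lim_image T w n d]
  exact Set.ncard_image_le (Set.toFinite _)

theorem unique_run [Finite Q] {J : Type} [Nonempty J] (F : J → Q → Prop) (w : ℕ → S) (κ : ℕ) (q : Q)
    (h1 : ∀ a b, κ ≤ (Set.range (cmp T w a b)).ncard)
    (h2 : ∀ a j, ∃ c d, a ≤ c ∧ (Set.range (cmp T w c d)).ncard ≤ κ ∧
      ∃ r ∈ Set.range (cmp T w c d), F j r ∧ cmp T w 0 c r = q) :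
    ∃ v : ℕ → Q, (∀ i, v i = T (w i) (v (i+1))) ∧ (∀ j n, ∃ m, n ≤ m ∧ F j (v m)) ∧ v 0 = q := by
  have hge : ∀ n, κ ≤ (lim T w n).ncard := by
    intro n
    obtain ⟨d, hd⟩ := lim_stab T w n
    rw [← hd 0]; exact h1 _ _
  have hsub : ∀ n d, lim T w n ⊆ Set.range (cmp T w n d) := fun n d => Set.iInter_subset _ d
  have hle : ∀ n, (lim T w n).ncard ≤ κ := by
    intro n
    obtain ⟨c, d, hc, hk, _⟩ := h2 n (Classical.arbitrary J)
    obtain ⟨e, rfl⟩ := Nat.exists_eq_add_of_le hc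
    exact (lim_card_mono T w n e).trans
      ((Set.ncard_le_ncard (hsub _ d) (Set.toFinite _)).trans hk)
  have hinj : ∀ n, Set.InjOn (cmp T w 0 n) (lim T w n) := by
    intro n
    apply Set.injOn_of_ncard_image_eq _ (Set.toFinite _)
    have := lim_image T w 0 n
    rw [Nat.zero_add] at this
    rw [this]
    exact le_antisymm ((hle _).trans (hge _)) ((hle _).trans (hge _))
  have h2' : ∀ a j, ∃ c, a ≤ c ∧ ∃ r ∈ lim T w c, F j r ∧ cmp T w 0 c r = q := by
    intro a j
    obtain ⟨c, d, hc, hk, r, hr, h3⟩ := h2 a j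
    refine ⟨c, hc, r, ?_, h3⟩
    rwa [Set.eq_of_subset_of_ncard_le (hsub c d) (hk.trans (hge c)) (Set.toFinite _)]
  have hv : ∀ n, ∃ v ∈ lim T w n, cmp T w 0 n v = q := by
    intro n
    obtain ⟨c, hc, r, hr, _, h4⟩ := h2' n (Classical.arbitrary J)
    obtain ⟨e, rfl⟩ := Nat.exists_eq_add_of_le hc
    refine ⟨cmp T w n e r, ?_, ?_⟩
    · rw [← lim_image T w n e]; exact ⟨r, hr, rfl⟩
    · rw [← h4, cmp_add, Nat.zero_add]
  choose v hv1 hv2 using hv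
  refine ⟨v, ?_, ?_, hv2 0⟩
  · intro i
    apply hinj i (hv1 i)
    · rw [← lim_image T w i 1]
      exact ⟨v (i+1), hv1 _, rfl⟩
    · rw [hv2 i, ← hv2 (i+1)]
      simp only [cmp, Nat.zero_add]
  · intro j n
    obtain ⟨c, hc, r, hr, h3, h4⟩ := h2' n j
    refine ⟨c, hc, ?_⟩
    rw [hinj c (hv1 c) hr (by rw [hv2, h4])]
    exact h3

/-- Sets recognised by a finite backward deterministic Büchi automaton. -/
def Recog (X : (ℕ → S) → Prop) : Prop :=
  ∃ (Q J : Type) (_ : Finite Q) (_ : Countable J) (_ : Nonempty J) (T : S → Q → Q)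
    (V : (ℕ → S) → Q) (F : J → Q → Prop) (out : Q → Prop),
    (∀ w, V w = T (w 0) (V (shift w 1))) ∧
    (∀ w j n, ∃ m, n ≤ m ∧ F j (V (shift w m))) ∧
    (∀ w (v : ℕ → Q), (∀ i, v i = T (w i) (v (i+1))) → (∀ j n, ∃ m, n ≤ m ∧ F j (v m)) →
      v 0 = V w) ∧
    (∀ w, X w ↔ out (V w))

theorem suffix_rtrk {w : ℕ → S} {w' : ℕ → S} {m m' : ℕ} (h : rtrk w' m' <:+ rtrk w m) :
    rtrk w' m' = rtrk w m' := by
  induction m with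
  | zero =>
    rcases m' with _ | m'
    · simp only [rtrk, List.suffix_cons_iff] at h
      rcases h with h | h
      · exact h
      · simp at h
    · have := h.length_le
      simp [rtrk_length] at this
  | succ m ih =>
    rw [rtrk, List.suffix_cons_iff] at h
    rcases h with h | h
    · have h' : rtrk w' m' = rtrk w (m+1) := h
      have := rtrk_idx h'
      subst this
      exact h'
    · exact ih h

theorem open_repr (O : ℕ → (ℕ → S) → Prop)
    (hO : ∀ m w w', (∀ i, i ≤ m → w i = w' i) → O m w → O m w') :
    ∃ D : List S → Prop, (∀ s q, D q → D (s :: q)) ∧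
      ∀ w, (∃ m, O m w) ↔ ∃ m, D (rtrk w m) := by
  refine ⟨fun q => ∃ w m, rtrk w m <:+ q ∧ O m w, ?_, ?_⟩
  · rintro s q ⟨w, m, h1, h2⟩
    exact ⟨w, m, h1.trans (List.suffix_cons _ _), h2⟩
  · intro w
    constructor
    · rintro ⟨m, hm⟩
      exact ⟨m, w, m, List.suffix_rfl, hm⟩
    · rintro ⟨m, w', m', h1, h2⟩
      exact ⟨m', hO m' w' w (rtrk_agree (suffix_rtrk h1)) h2⟩

theorem sigma3 {X : (ℕ → S) → Prop} (hX : Recog X) :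
    ∃ D : ℕ → ℕ → List S → Prop, (∀ n k s q, D n k q → D n k (s :: q)) ∧
      ∀ w, X w ↔ ∃ n, ∀ k, ∃ m, D n k (rtrk w m) := by
  obtain ⟨Q, J, _, _, _, T, V, F, out, hV, hF, hU, hout⟩ := hX
  rcases isEmpty_or_nonempty S with hS | hS
  · exact ⟨fun _ _ _ => False, fun _ _ _ _ h => h, fun w => (hS.false (w 0)).elim⟩
  have hQ : Nonempty Q := ⟨V (fun _ => Classical.arbitrary S)⟩
  let O : ℕ × ℕ × Q → ℕ × ℕ × J → ℕ → (ℕ → S) → Prop := fun i j m w =>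
    i.1 + j.1 + j.2.1 ≤ m ∧ out (cmp T w 0 i.1 i.2.2) ∧
      i.2.1 ≤ (Set.range (cmp T w (i.1 + j.1) j.2.1)).ncard ∧
      ∃ c d, j.1 ≤ c ∧ i.1 + c + d ≤ m ∧ (Set.range (cmp T w (i.1 + c) d)).ncard ≤ i.2.1 ∧
        ∃ r ∈ Set.range (cmp T w (i.1 + c) d), F j.2.2 r ∧ cmp T w i.1 c r = i.2.2
  have hO : ∀ i j m w w', (∀ i, i ≤ m → w i = w' i) → O i j m w → O i j m w' := by
    rintro i j m w w' hag ⟨h1, h2, h3, c, d, h4, h5, h6, r, h7, h8, h9⟩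
    have e1 : cmp T w 0 i.1 = cmp T w' 0 i.1 := cmp_congr T fun k hk => hag k (by omega)
    have e2 : cmp T w (i.1 + j.1) j.2.1 = cmp T w' (i.1 + j.1) j.2.1 :=
      cmp_congr T fun k hk => hag k (by omega)
    have e3 : cmp T w (i.1 + c) d = cmp T w' (i.1 + c) d := cmp_congr T fun k hk => hag k (by omega)
    have e4 : cmp T w i.1 c = cmp T w' i.1 c := cmp_congr T fun k hk => hag k (by omega)
    rw [e1] at h2
    rw [e2] at h3
    rw [e3] at h6 h7
    rw [e4] at h9
    exact ⟨h1, h2, h3, c, d, h4, h5, h6, r, h7, h8, h9⟩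
  have hXO : ∀ w, X w ↔ ∃ i, ∀ j, ∃ m, O i j m w := by
    intro w
    rw [hout]
    constructor
    · intro ho
      obtain ⟨x, ⟨N, rfl⟩, hN⟩ := Set.exists_max_image (Set.range (lim T w)) Set.ncard
        (Set.toFinite _) ⟨_, 0, rfl⟩
      refine ⟨(N, (lim T w N).ncard, V (shift w N)), ?_⟩
      rintro ⟨a, b, j⟩
      obtain ⟨c, hc, hFc⟩ := hF (shift w N) j a
      rw [shift_shift] at hFc
      obtain ⟨d, hd⟩ := lim_stab T w (N + c)
      refine ⟨(N + a + b) + (N + c + d), by simp only; omega, ?_, ?_, c, d, hc, by simp only; omega,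
        ?_, V (shift w (N + c)), ?_, hFc, ?_⟩
      · have := cmp_V T hV w 0 N
        rw [Nat.zero_add, shift_zero] at this
        simp only
        rw [← this]; exact ho
      · exact (lim_card_mono T w N a).trans
          (Set.ncard_le_ncard (Set.iInter_subset _ b) (Set.toFinite _))
      · have := hd 0
        rw [Nat.add_zero] at this
        simp only
        rw [this]; exact hN _ ⟨_, rfl⟩
      · exact ⟨_, (cmp_V T hV w (N + c) d).symm⟩
      · exact (cmp_V T hV w N c).symm
    · rintro ⟨⟨N, κ, q⟩, h⟩
      obtain ⟨v, hv1, hv2, hv3⟩ := unique_run T F (shift w N) κ q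
        (by
          intro a b
          obtain ⟨m, -, -, h3, -⟩ := h (a, b, Classical.arbitrary J)
          rw [cmp_shift]; exact h3)
        (by
          intro a j
          obtain ⟨m, -, -, -, c, d, h4, h5, h6, r, h7, h8, h9⟩ := h (a, 0, j)
          refine ⟨c, d, h4, ?_⟩
          rw [cmp_shift, cmp_shift]
          exact ⟨h6, r, h7, h8, h9⟩)
      obtain ⟨m, -, h2, -⟩ := h (0, 0, Classical.arbitrary J)
      have h3 := hU _ v hv1 hv2
      rw [hv3] at h3
      have := cmp_V T hV w 0 N
      rw [Nat.zero_add, shift_zero, ← h3] at this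
      rw [this]; exact h2
  choose D hD1 hD2 using fun i j => open_repr (O i j) (hO i j)
  obtain ⟨f, hf⟩ := exists_surjective_nat (ℕ × ℕ × Q)
  obtain ⟨g, hg⟩ := exists_surjective_nat (ℕ × ℕ × J)
  refine ⟨fun n k => D (f n) (g k), fun n k => hD1 _ _, fun w => ?_⟩
  rw [hXO, hf.exists]
  refine exists_congr fun n => ?_
  rw [hg.forall]
  exact forall_congr' fun k => hD2 _ _ w

theorem recog_head (P : S → Prop) : Recog (fun w : ℕ → S => P (w 0)) := by
  refine ⟨Prop, Unit, inferInstance, inferInstance, inferInstance, fun a _ => P a,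
    fun w => P (w 0), fun _ _ => True, fun b => b, fun w => rfl, fun w j n => ⟨n, le_rfl, trivial⟩,
    fun w v h _ => h 0, fun w => Iff.rfl⟩

theorem recog_neg {X : (ℕ → S) → Prop} (h : Recog X) : Recog (fun w => ¬ X w) := by
  obtain ⟨Q, J, i1, i2, i3, T, V, F, out, hV, hF, hU, hout⟩ := h
  exact ⟨Q, J, i1, i2, i3, T, V, F, fun q => ¬ out q, hV, hF, hU, fun w => not_congr (hout w)⟩

theorem run_shift {J : Type} {T : S → Q → Q} {V : (ℕ → S) → Q} {F : J → Q → Prop}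
    (hU : ∀ w (v : ℕ → Q), (∀ i, v i = T (w i) (v (i+1))) → (∀ j n, ∃ m, n ≤ m ∧ F j (v m)) →
      v 0 = V w) (w : ℕ → S) (v : ℕ → Q) (h1 : ∀ i, v i = T (w i) (v (i+1)))
    (h2 : ∀ j n, ∃ m, n ≤ m ∧ F j (v m)) (i : ℕ) : v i = V (shift w i) := by
  have := hU (shift w i) (fun k => v (k + i)) (by
    intro k
    simp only [shift]
    rw [h1 (k + i)]
    congr 2; omega) (by
    intro j n
    obtain ⟨m, hm, hh⟩ := h2 j (n + i)
    refine ⟨m - i, by omega, ?_⟩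
    rwa [Nat.sub_add_cancel (by omega)])
  simpa using this

theorem recog_next {X : (ℕ → S) → Prop} (h : Recog X) : Recog (fun w => X (shift w 1)) := by
  obtain ⟨Q, J, i1, i2, i3, T, V, F, out, hV, hF, hU, hout⟩ := h
  refine ⟨Q × Prop, J, inferInstance, i2, i3, fun a q => (T a q.1, out q.1),
    fun w => (V w, out (V (shift w 1))), fun j q => F j q.1, fun q => q.2, ?_, ?_, ?_, ?_⟩
  · intro w; simp only [← hV]
  · intro w j n; exact hF w j n
  · intro w v h1 h2
    have key := run_shift hU w (fun i => (v i).1) (fun i => by rw [h1 i]) h2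
    rw [h1 0]
    simp only [key]
    rw [hV w]
  · intro w; exact hout _

theorem recog_or {X Y : (ℕ → S) → Prop} (hX : Recog X) (hY : Recog Y) :
    Recog (fun w => X w ∨ Y w) := by
  obtain ⟨Q, J, i1, i2, i3, T, V, F, out, hV, hF, hU, hout⟩ := hX
  obtain ⟨Q', J', i1', i2', i3', T', V', F', out', hV', hF', hU', hout'⟩ := hY
  refine ⟨Q × Q', J ⊕ J', inferInstance, inferInstance, inferInstance,
    fun a q => (T a q.1, T' a q.2), fun w => (V w, V' w),
    fun j q => j.elim (fun j => F j q.1) (fun j => F' j q.2), fun q => out q.1 ∨ out' q.2,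
    ?_, ?_, ?_, ?_⟩
  · intro w; simp only [← hV, ← hV']
  · rintro w (j | j) n
    · exact hF w j n
    · exact hF' w j n
  · intro w v h1 h2
    apply Prod.ext
    · exact hU w (fun i => (v i).1) (fun i => by rw [h1 i]) (fun j n => h2 (Sum.inl j) n)
    · exact hU' w (fun i => (v i).2) (fun i => by rw [h1 i]) (fun j n => h2 (Sum.inr j) n)
  · intro w; exact or_congr (hout w) (hout' w)

theorem recog_until {X Y : (ℕ → S) → Prop} (hX : Recog X) (hY : Recog Y) :
    Recog (fun w => ∃ j : ℕ, Y (shift w j) ∧ ∀ k < j, X (shift w k)) := by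
  obtain ⟨Q, J, i1, i2, i3, T, V, F, out, hV, hF, hU, hout⟩ := hX
  obtain ⟨Q', J', i1', i2', i3', T', V', F', out', hV', hF', hU', hout'⟩ := hY
  have hunf : ∀ w, (∃ j : ℕ, Y (shift w j) ∧ ∀ k < j, X (shift w k)) ↔
      (Y w ∨ (X w ∧ ∃ j : ℕ, Y (shift (shift w 1) j) ∧ ∀ k < j, X (shift (shift w 1) k))) := by
    intro w
    constructor
    · rintro ⟨_ | j, h1, h2⟩
      · exact Or.inl h1
      · refine Or.inr ⟨h2 0 (by omega), j, h1, fun k hk => h2 (k+1) (by omega)⟩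
    · rintro (h | ⟨h1, j, h2, h3⟩)
      · exact ⟨0, h, fun k hk => by omega⟩
      · refine ⟨j+1, h2, fun k hk => ?_⟩
        rcases k with _ | k
        · exact h1
        · exact h3 k (by omega)
  set Z : (ℕ → S) → Prop := fun w => ∃ j : ℕ, Y (shift w j) ∧ ∀ k < j, X (shift w k) with hZ
  have hunf' : ∀ w, Z w ↔ (out' (V' w) ∨ (out (V w) ∧ Z (shift w 1))) := by
    intro w
    rw [← hout, ← hout']; exact hunf w
  refine ⟨Q × Q' × Prop, J ⊕ J' ⊕ Unit, inferInstance, inferInstance, inferInstance,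
    fun a q => (T a q.1, T' a q.2.1, out' (T' a q.2.1) ∨ (out (T a q.1) ∧ q.2.2)),
    fun w => (V w, V' w, Z w),
    fun j q => j.elim (fun j => F j q.1) (fun j => j.elim (fun j => F' j q.2.1)
      (fun _ => out' q.2.1 ∨ ¬ q.2.2)), fun q => q.2.2,
    ?_, ?_, ?_, ?_⟩
  · intro w; simp only [← hV, ← hV', ← hunf']
  · rintro w (j | j | j) n
    · exact hF w j n
    · exact hF' w j n
    · by_cases hz : Z (shift w n)
      · obtain ⟨j, h1, -⟩ := hz
        rw [shift_shift] at h1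
        exact ⟨n + j, by omega, Or.inl ((hout' _).1 h1)⟩
      · exact ⟨n, le_rfl, Or.inr hz⟩
  · intro w v h1 h2
    have k1 := run_shift hU w (fun i => (v i).1) (fun i => by rw [h1 i])
      (fun j n => h2 (Sum.inl j) n)
    have k2 := run_shift hU' w (fun i => (v i).2.1) (fun i => by rw [h1 i])
      (fun j n => h2 (Sum.inr (Sum.inl j)) n)
    have k3 : ∀ i, (v i).2.2 ↔
        (Y (shift w i) ∨ (X (shift w i) ∧ (v (i+1)).2.2)) := by
      intro i
      rw [hout, hout', ← k1, ← k2, h1 i]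
    have k4 : ∀ m i, (v i).2.2 → (Y (shift w (i + m)) ∨ ¬ (v (i + m)).2.2) → Z (shift w i) := by
      intro m
      induction m with
      | zero =>
        intro i a b
        rcases b with b | b
        · exact ⟨0, b, fun k hk => by omega⟩
        · exact absurd a b
      | succ m ih =>
        intro i a b
        rw [hunf', ← hout, ← hout']
        rcases (k3 i).1 a with c | ⟨c, d⟩
        · exact Or.inl c
        · refine Or.inr ⟨c, ?_⟩
          rw [shift_shift]
          apply ih (i+1) d
          have : i + 1 + m = i + (m + 1) := by omega
          rw [this]; exact b
    have k5 : ∀ j i, Y (shift w (i + j)) → (∀ k < j, X (shift w (i + k))) → (v i).2.2 := by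
      intro j
      induction j with
      | zero => intro i a _; exact (k3 i).2 (Or.inl a)
      | succ j ih =>
        intro i a b
        refine (k3 i).2 (Or.inr ⟨b 0 (by omega), ih (i+1) ?_ ?_⟩)
        · have : i + 1 + j = i + (j + 1) := by omega
          rw [this]; exact a
        · intro k hk
          have : i + 1 + k = i + (k + 1) := by omega
          rw [this]; exact b (k+1) (by omega)
    refine Prod.ext (k1 0) (Prod.ext (k2 0) (propext ⟨fun a => ?_, ?_⟩))
    · obtain ⟨m, _, hm⟩ := h2 (Sum.inr (Sum.inr ())) 0
      refine k4 m 0 a ?_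
      rw [Nat.zero_add, hout', ← k2 m]
      exact hm
    · rintro ⟨j, a, b⟩
      refine k5 j 0 ?_ ?_
      · rw [Nat.zero_add]; exact a
      · intro k hk; rw [Nat.zero_add]; exact b k hk
  · intro w; exact Iff.rfl

theorem recog_sat {AP Ag Ac : Type} (G : CGS AP Ag Ac S) (φ : ATLs AP Ag) :
    Recog (fun w => ATLs.sat G φ w) := by
  induction φ with
  | tt => simpa only [ATLs.sat] using recog_head (fun _ : S => True)
  | atom p => simpa only [ATLs.sat] using recog_head (fun a : S => p ∈ G.lab a)
  | neg φ ih => simpa only [ATLs.sat] using recog_neg ih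
  | or φ ψ ih1 ih2 => simpa only [ATLs.sat] using recog_or ih1 ih2
  | next φ ih => simpa only [ATLs.sat] using recog_next ih
  | untl φ ψ ih1 ih2 => simpa only [ATLs.sat] using recog_until ih1 ih2
  | coal A φ ih =>
    simp only [ATLs.sat]
    exact recog_head (fun a : S => ∃ f : List S → (A → Ac), CGS.StratOK G A f ∧
      ∀ π' : ℕ → S, CGS.Outcome G A f a π' → ATLs.sat G φ π')

end Automata

section Final

open CGS

variable {AP Ag Ac S : Type}

theorem trk_eq (w : ℕ → S) (n : ℕ) : trk w n = (rtrk w n).reverse := by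
  induction n with
  | zero => simp [trk, rtrk]
  | succ n ih =>
    rw [rtrk, List.reverse_cons, ← ih, trk, List.ofFn_succ', List.concat_eq_append]
    simp [trk]

theorem lst_trk (G : CGS AP Ag Ac S) (w : ℕ → S) (n : ℕ) : G.lst (trk w n) = w n := by
  rw [trk_eq]
  cases n <;> simp [rtrk, lst]

theorem trk_ne (w : ℕ → S) (n : ℕ) : trk w n ≠ [] := by
  simp [trk]

theorem combine_self (A : Set Ag) (d : Ag → Ac) : combine A (fun a => d a) d = d := by
  funext a; simp [combine]

/-- The states reachable once `A` commits to a decision. -/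
def eff (G : CGS AP Ag Ac S) (A : Set Ag) (s : S) (dA : A → Ac) : Set S :=
  {s' | ∃ d', G.tau s (combine A dA d') = some s'}

/-- The effectivity game. -/
def moves (G : CGS AP Ag Ac S) (A : Set Ag) (q : List S) : Set (Set S) :=
  {U | ∃ dA, G.Avail A (G.lst q.reverse) dA ∧ U = eff G A (G.lst q.reverse) dA}

theorem moves_nonempty (G : CGS AP Ag Ac S) (A : Set Ag) (q : List S) :
    (moves G A q).Nonempty := by
  obtain ⟨d, hd⟩ := G.total (G.lst q.reverse)
  exact ⟨_, fun a => d a, ⟨d, by rw [combine_self]; exact hd⟩, rfl⟩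

theorem exists_play (_G : CGS AP Ag Ac S) (s : S) (R : List S → S → Prop)
    (hR : ∀ q, q ≠ [] → ∃ s', R q s') :
    ∃ w : ℕ → S, w 0 = s ∧ ∀ i, R (rtrk w i) (w (i+1)) := by
  have hR' : ∀ q, ∃ s', q ≠ [] → R q s' := by
    intro q
    by_cases h : q = []
    · exact ⟨s, fun h' => absurd h h'⟩
    · obtain ⟨s', hs⟩ := hR q h; exact ⟨s', fun _ => hs⟩
  choose nx hnx using hR'
  let pos : ℕ → List S := fun n => Nat.rec [s] (fun _ q => nx q :: q) n
  let w : ℕ → S := fun n => (pos n).headD s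
  have hpos : ∀ n, rtrk w n = pos n := by
    intro n
    induction n with
    | zero => rfl
    | succ n ih => rw [rtrk, ih]; rfl
  refine ⟨w, rfl, fun i => ?_⟩
  have : w (i+1) = nx (rtrk w i) := by rw [hpos]; rfl
  rw [this]
  apply hnx
  rw [← List.length_pos_iff_ne_nil, rtrk_length]; omega

theorem lst_rtrk (G : CGS AP Ag Ac S) (w : ℕ → S) (n : ℕ) : G.lst (rtrk w n).reverse = w n := by
  rw [← trk_eq, lst_trk]

end Final

end Duality

open CGS Duality

/-- duality of the strategic quantifier and counter strategies:
`G, s ⊨ [[A]]φ` (i.e. `¬⟨⟨A⟩⟩¬φ`) iff some counter strategy for `A` enforces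
`φ` on all its outcome plays from `s` (for finite CGS). -/
theorem counter_strategy_duality {AP Ag Ac S : Type}
    [Finite S] [Finite Ac] [Finite Ag]
    (G : CGS AP Ag Ac S) (s : S) (A : Set Ag) (φ : ATLs AP Ag) :
    ATLs.satState G s (ATLs.neg (ATLs.coal A (ATLs.neg φ))) ↔
      ∃ fc : List S → (A → Ac) → (Ag → Ac), CGS.CStratOK G A fc ∧
        ∀ π : ℕ → S, CGS.COutcome G A fc s π → ATLs.sat G φ π := by
  constructor
  · rintro ⟨π, -, hπ0, hπ⟩
    simp only [ATLs.sat] at hπ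
    rw [hπ0] at hπ
    obtain ⟨D, hD1, hD2⟩ := sigma3 (recog_neg (recog_sat G φ))
    obtain ⟨Z, hZ1, hZ2, hZ3⟩ := determinacy (moves G A) (moves_nonempty G A)
      {w | ¬ ATLs.sat G φ w} D hD1 hD2 [s] (by
        rintro ⟨f, hf, hwin⟩
        choose g hg1 hg2 using hf
        apply hπ
        refine ⟨fun ν => g ν.reverse, ?_, ?_⟩
        · intro ν _
          have := hg1 ν.reverse
          rwa [List.reverse_reverse] at this
        · rintro π' ⟨h0, h1⟩
          refine hwin π' 0 (by rw [rtrk, h0]) ?_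
          intro m _
          refine ⟨?_, trivial⟩
          rw [hg2, lst_rtrk]
          obtain ⟨d', hd'⟩ := h1 m
          rw [trk_eq] at hd'
          simp only [List.reverse_reverse] at hd'
          exact ⟨d', hd'⟩)
    have hch : ∀ (ν : List S) (dA : A → Ac), ∃ d' : Ag → Ac, G.Avail A (G.lst ν) dA →
        (G.tau (G.lst ν) (combine A dA d')).isSome ∧
        (ν.reverse ∈ Z → ∀ s', G.tau (G.lst ν) (combine A dA d') = some s' →
          s' :: ν.reverse ∈ Z) := by
      intro ν dA
      by_cases hav : G.Avail A (G.lst ν) dA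
      · by_cases hz : ν.reverse ∈ Z
        · obtain ⟨s', ⟨d', hd'⟩, hs'⟩ := hZ2 _ hz (eff G A (G.lst ν) dA)
            ⟨dA, by rw [List.reverse_reverse]; exact ⟨hav, rfl⟩⟩
          refine ⟨d', fun _ => ⟨by rw [hd']; rfl, fun _ s'' hs'' => ?_⟩⟩
          rw [hd'] at hs''
          cases hs''
          exact hs'
        · obtain ⟨d', hd'⟩ := hav
          exact ⟨d', fun _ => ⟨hd', fun h => absurd h hz⟩⟩
      · obtain ⟨d, _⟩ := G.total s
        exact ⟨d, fun h => absurd h hav⟩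
    choose fc hfc using hch
    refine ⟨fc, fun ν _ dA hav => (hfc ν dA hav).1, ?_⟩
    rintro w ⟨h0, h1⟩
    by_contra hns
    refine hZ3 w 0 (by rw [rtrk, h0]) ?_ hns
    intro m _
    induction m with
    | zero => rw [rtrk, h0]; exact hZ1
    | succ m ih =>
      obtain ⟨dA, hav, ht⟩ := h1 m
      have := hfc (trk w m) dA
      rw [lst_trk] at this
      have := (this hav).2
      rw [trk_eq, List.reverse_reverse, ← trk_eq] at this
      exact this (ih (by omega)) _ ht
  · rintro ⟨fc, hok, hfc⟩
    obtain ⟨π, hπ0, hπ⟩ := exists_play G s (fun q s' => Succ G (G.lst q.reverse) s') (by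
      intro q _
      obtain ⟨d, hd⟩ := G.total (G.lst q.reverse)
      obtain ⟨s', hs'⟩ := Option.isSome_iff_exists.1 hd
      exact ⟨s', d, hs'⟩)
    refine ⟨π, fun i => ?_, hπ0, ?_⟩
    · have := hπ i
      rwa [lst_rtrk] at this
    · simp only [ATLs.sat]
      rw [hπ0]
      rintro ⟨f, hf, hout⟩
      obtain ⟨w, hw0, hw⟩ := exists_play G s (fun q s' =>
        G.tau (G.lst q.reverse) (combine A (f q.reverse) (fc q.reverse (f q.reverse))) = some s') (by
        intro q hq
        have hq' : q.reverse ≠ [] := by simpa using hq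
        exact Option.isSome_iff_exists.1 (hok _ hq' _ (hf _ hq')))
      have hw' : ∀ i, G.tau (w i) (combine A (f (trk w i)) (fc (trk w i) (f (trk w i)))) =
          some (w (i+1)) := by
        intro i
        have := hw i
        rwa [lst_rtrk, ← trk_eq] at this
      refine hout w ⟨hw0, fun i => ⟨_, hw' i⟩⟩ (hfc w ⟨hw0, fun i => ⟨f (trk w i), ?_, hw' i⟩⟩)
      have := hf (trk w i) (trk_ne w i)
      rwa [lst_trk] at this
end

section
/- Let Φ be an ATL* state formula over AP and B_Φ its set of basic subformulas. A concurrent game tree T over AP is a model of Φ if and only if there exists a B_Φ-labeling extension of T that is well-formed with respect to Φ. -/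
open scoped Classical

/-- A concurrent game tree with directions `Υ`: nodes form a prefix-closed
set of finite sequences, and the children of a node are exactly its
successors. -/
structure CGT (AP Ag Ac Υ : Type) where
  nodes : Set (List Υ)
  root_mem : ([] : List Υ) ∈ nodes
  prefix_closed : ∀ ν : List Υ, ∀ x : Υ, ν ++ [x] ∈ nodes → ν ∈ nodes
  lab : List Υ → Set AP
  tau : List Υ → (Ag → Ac) → Option Υ
  tau_mem : ∀ ν ∈ nodes, ∀ (d : Ag → Ac) (x : Υ),
      tau ν d = some x → ν ++ [x] ∈ nodes
  children_succ : ∀ ν ∈ nodes, ∀ x : Υ,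
      ν ++ [x] ∈ nodes → ∃ d : Ag → Ac, tau ν d = some x
  total : ∀ ν ∈ nodes, ∃ (d : Ag → Ac) (x : Υ), tau ν d = some x

namespace CGT

variable {AP Ag Ac Υ : Type}

/-- A concurrent game tree as a CGS over its nodes. -/
noncomputable def toCGS (T : CGT AP Ag Ac Υ) :
    CGS AP Ag Ac {ν : List Υ // ν ∈ T.nodes} where
  init := ⟨[], T.root_mem⟩
  lab ν := T.lab ν.1
  tau ν d := (T.tau ν.1 d).bind fun x =>
    if h : ν.1 ++ [x] ∈ T.nodes then some ⟨ν.1 ++ [x], h⟩ else none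
  total := by
    rintro ⟨ν, hν⟩
    obtain ⟨d, x, hd⟩ := T.total ν hν
    exact ⟨d, by simp [hd, T.tau_mem ν hν d x hd]⟩

end CGT

namespace ATLs

variable {AP Ag : Type}

/-- The set of subformulas of a formula. -/
def subf : ATLs AP Ag → Set (ATLs AP Ag)
  | tt => {tt}
  | atom p => {atom p}
  | neg φ => insert (neg φ) (subf φ)
  | or φ ψ => insert (or φ ψ) (subf φ ∪ subf ψ)
  | next φ => insert (next φ) (subf φ)
  | untl φ ψ => insert (untl φ ψ) (subf φ ∪ subf ψ)
  | coal A φ => insert (coal A φ) (subf φ)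

/-- The set `B_Φ` of basic subformulas of `Φ`. -/
def basics (Φ : ATLs AP Ag) : Set (ATLs AP Ag) :=
  {β | β ∈ subf Φ ∧ ∃ (A : Set Ag) (ψ : ATLs AP Ag), β = coal A ψ}

/-- LTL satisfaction of `[φ]_LTL` over an infinite word whose letters are
sets of atomic propositions in `AP ∪ B_Φ`: basic formulas are read as
atoms. -/
def ltlSat (w : ℕ → Set (AP ⊕ ATLs AP Ag)) : ATLs AP Ag → Prop
  | tt => True
  | atom p => Sum.inl p ∈ w 0
  | neg φ => ¬ ltlSat w φ
  | or φ ψ => ltlSat w φ ∨ ltlSat w ψ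
  | next φ => ltlSat (fun i => w (i + 1)) φ
  | untl φ ψ => ∃ j : ℕ, ltlSat (fun i => w (i + j)) ψ ∧
      ∀ k < j, ltlSat (fun i => w (i + k)) φ
  | coal A φ => Sum.inr (coal A φ) ∈ w 0

end ATLs

namespace CGT

variable {AP Ag Ac Υ : Type}

/-- `lab'` is a `B`-labeling extension of the tree `T`. -/
def IsLabExt (T : CGT AP Ag Ac Υ)
    (lab' : List Υ → Set (AP ⊕ ATLs AP Ag)) : Prop :=
  ∀ ν ∈ T.nodes, Sum.inl ⁻¹' lab' ν = T.lab ν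

/-- Positive well-formedness w.r.t. the basic formula `⟨⟨A⟩⟩ψ`. -/
def PosWF (T : CGT AP Ag Ac Υ) (lab' : List Υ → Set (AP ⊕ ATLs AP Ag))
    (A : Set Ag) (ψ : ATLs AP Ag) : Prop :=
  ∀ ν : {x : List Υ // x ∈ T.nodes}, Sum.inr (ATLs.coal A ψ) ∈ lab' ν.1 →
    ∃ f : List {x : List Υ // x ∈ T.nodes} → (A → Ac),
      CGS.StratOK T.toCGS A f ∧
      ∀ π, CGS.Outcome T.toCGS A f ν π →
        ATLs.ltlSat (fun i => lab' (π i).1) ψ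

/-- Negative well-formedness w.r.t. the basic formula `⟨⟨A⟩⟩ψ`. -/
def NegWF (T : CGT AP Ag Ac Υ) (lab' : List Υ → Set (AP ⊕ ATLs AP Ag))
    (A : Set Ag) (ψ : ATLs AP Ag) : Prop :=
  ∀ ν : {x : List Υ // x ∈ T.nodes}, Sum.inr (ATLs.coal A ψ) ∉ lab' ν.1 →
    ∃ fc : List {x : List Υ // x ∈ T.nodes} → (A → Ac) → (Ag → Ac),
      CGS.CStratOK T.toCGS A fc ∧
      ∀ π, CGS.COutcome T.toCGS A fc ν π →
        ATLs.ltlSat (fun i => lab' (π i).1) (ATLs.neg ψ)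

/-- `lab'` is well-formed with respect to `Φ`: positively and negatively
well-formed w.r.t. every basic subformula of `Φ`, and the root label is a
(propositional) model of `[Φ]_LTL`. -/
def WellFormed (T : CGT AP Ag Ac Υ) (lab' : List Υ → Set (AP ⊕ ATLs AP Ag))
    (Φ : ATLs AP Ag) : Prop :=
  (∀ (A : Set Ag) (ψ : ATLs AP Ag), ATLs.coal A ψ ∈ ATLs.basics Φ →
      PosWF T lab' A ψ ∧ NegWF T lab' A ψ) ∧
  ATLs.ltlSat (fun _ => lab' []) Φ

end CGT


namespace DV

variable {X : Type}

/-- reversed prefix -/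
def pre (g : ℕ → X) : ℕ → List X
  | 0 => []
  | n + 1 => g n :: pre g n

theorem pre_len (g : ℕ → X) (n : ℕ) : (pre g n).length = n := by
  induction n with
  | zero => rfl
  | succ n ih => simp [pre, ih]

theorem pre_suffix (g : ℕ → X) {m n : ℕ} (h : m ≤ n) : pre g m <:+ pre g n := by
  induction n, h using Nat.le_induction with
  | base => exact List.suffix_rfl
  | succ n _ ih => exact ih.trans (List.suffix_cons _ _)

theorem suffix_pre (g : ℕ → X) {n : ℕ} {q : List X} (h : q <:+ pre g n) :
    q = pre g q.length := by
  have hl : q.length ≤ n := by simpa [pre_len] using h.length_le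
  have h2 := pre_suffix g hl
  exact (List.suffix_of_suffix_length_le h h2 (by simp [pre_len])).eq_of_length (by simp [pre_len])

/-- I can win from `p` inside `T`, where positions in `W` count as already won. -/
def IW (F : List X → Set (Set X)) (T : Set (List X)) (W : List X → Prop) (p : List X)
    (A : Set (ℕ → X)) : Prop :=
  ∃ σ : Set (List X), σ ⊆ T ∧ p ∈ σ ∧
    (∀ q ∈ σ, ∃ D ∈ F q, ∀ x ∈ D, x :: q ∈ T → x :: q ∈ σ ∨ W (x :: q)) ∧
    ∀ g : ℕ → X, pre g p.length = p → (∀ n, p.length ≤ n → pre g n ∈ σ) → g ∈ A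

def IIq (F : List X → Set (Set X)) (T : Set (List X)) : Prop :=
  ∀ q ∈ T, ∀ D ∈ F q, ∃ x ∈ D, x :: q ∈ T

abbrev IWin (F : List X → Set (Set X)) (T : Set (List X)) (p : List X)
    (A : Set (ℕ → X)) : Prop := IW F T (fun _ => False) p A

/-- memory for the phase-switching strategy -/
noncomputable def mem (Stop : ℕ → List X → Prop) (p : List X) : List X → ℕ × List X
  | [] => (0, p)
  | x :: q => if (x :: q).length ≤ p.length then (0, p) else
      if Stop (mem Stop p q).1 (x :: q) then ((mem Stop p q).1 + 1, x :: q) else mem Stop p q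

theorem comp (F : List X → Set (Set X)) (T : Set (List X)) (W : List X → Prop)
    (A : Set (ℕ → X)) (Stop Bad : ℕ → List X → Prop)
    (h1 : ∀ n, ∀ r ∈ T, Bad n r → IW F T (fun q => Stop n q ∨ W q) r A)
    (h2 : ∀ n, ∀ q ∈ T, Stop n q → Bad (n + 1) q)
    (p : List X) (hp : p ∈ T) (hb : Bad 0 p) :
    IW F T W p (A ∪ {g | ∀ n, ∃ m, Stop n (pre g m)}) := by
  have h1' : ∀ n, ∀ r, ∃ σ : Set (List X), r ∈ T → Bad n r → (σ ⊆ T ∧ r ∈ σ ∧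
    (∀ q ∈ σ, ∃ D ∈ F q, ∀ x ∈ D, x :: q ∈ T → x :: q ∈ σ ∨ (Stop n (x :: q) ∨ W (x :: q))) ∧
    ∀ g : ℕ → X, pre g r.length = r → (∀ n, r.length ≤ n → pre g n ∈ σ) → g ∈ A) := by
    intro n r
    by_cases h : r ∈ T ∧ Bad n r
    · obtain ⟨σ, hσ⟩ := h1 n r h.1 h.2
      exact ⟨σ, fun _ _ => hσ⟩
    · exact ⟨∅, fun a b => absurd ⟨a, b⟩ h⟩
  choose S hS using h1'
  have memp : ∀ q : List X, q.length ≤ p.length → mem Stop p q = (0, p) := by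
    intro q hq
    cases q with
    | nil => rfl
    | cons x q => rw [mem, if_pos hq]
  have memc : ∀ (x : X) (q : List X), p.length ≤ q.length → mem Stop p (x :: q) =
      if Stop (mem Stop p q).1 (x :: q) then ((mem Stop p q).1 + 1, x :: q) else mem Stop p q := by
    intro x q hq
    rw [mem, if_neg (by simp; omega)]
  refine ⟨{q | q ∈ T ∧ p <:+ q ∧ q ∈ S (mem Stop p q).1 (mem Stop p q).2 ∧
    (mem Stop p q).2 ∈ T ∧ Bad (mem Stop p q).1 (mem Stop p q).2}, fun q hq => hq.1, ?_, ?_, ?_⟩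
  · have := memp p le_rfl
    simp only [Set.mem_ofPred_eq, this]
    exact ⟨hp, List.suffix_rfl, (hS 0 p hp hb).2.1, hp, hb⟩
  · rintro q ⟨hqT, hpq, hqS, hrT, hrB⟩
    obtain ⟨D, hD, hx⟩ := (hS _ _ hrT hrB).2.2.1 q hqS
    refine ⟨D, hD, fun x hxD hxT => ?_⟩
    by_cases hs : Stop (mem Stop p q).1 (x :: q)
    · left
      have hm := memc x q hpq.length_le
      rw [if_pos hs] at hm
      have hB := h2 _ _ hxT hs
      simp only [Set.mem_ofPred_eq, hm]
      exact ⟨hxT, hpq.trans (List.suffix_cons _ _), (hS _ _ hxT hB).2.1, hxT, hB⟩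
    · rcases hx x hxD hxT with h | h | h
      · left
        have hm := memc x q hpq.length_le
        rw [if_neg hs] at hm
        simp only [Set.mem_ofPred_eq, hm]
        exact ⟨hxT, hpq.trans (List.suffix_cons _ _), h, hrT, hrB⟩
      · exact absurd h hs
      · exact Or.inr h
  · intro g hg hσ
    by_cases hinf : ∀ n, ∃ m, Stop n (pre g m)
    · exact Or.inr hinf
    left
    -- find the final phase
    have hstep : ∀ m, p.length ≤ m → mem Stop p (pre g (m+1)) =
        if Stop (mem Stop p (pre g m)).1 (pre g (m+1))
          then ((mem Stop p (pre g m)).1 + 1, pre g (m+1)) else mem Stop p (pre g m) := by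
      intro m hm
      exact memc (g m) (pre g m) (by simpa [pre_len] using hm)
    -- invariant: start of phase
    have hinv : ∀ m, p.length ≤ m → ∃ k, p.length ≤ k ∧ k ≤ m ∧
        (mem Stop p (pre g m)).2 = pre g k ∧
        ∀ l, k ≤ l → l ≤ m → mem Stop p (pre g l) = mem Stop p (pre g m) := by
      intro m hm
      induction m, hm using Nat.le_induction with
      | base =>
        refine ⟨p.length, le_rfl, le_rfl, ?_, fun l h h' => by rw [le_antisymm h h']⟩
        rw [hg, memp p le_rfl]
      | succ m hm ih =>
        obtain ⟨k, hk, hkm, he, hl⟩ := ih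
        by_cases hs : Stop (mem Stop p (pre g m)).1 (pre g (m+1))
        · have := hstep m hm
          rw [if_pos hs] at this
          exact ⟨m+1, by omega, le_rfl, by rw [this], fun l h h' => by rw [le_antisymm h h']⟩
        · have := hstep m hm
          rw [if_neg hs] at this
          refine ⟨k, hk, by omega, by rw [this, he], fun l h h' => ?_⟩
          rcases Nat.lt_or_ge m l with h3 | h3
          · rw [show l = m+1 by omega]
          · rw [this]; exact hl l h h3
    have hbdd : ∃ N, ∀ m, p.length ≤ m → (mem Stop p (pre g m)).1 ≤ N := by
      push Not at hinf
      obtain ⟨n, hn⟩ := hinf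
      refine ⟨n, fun m hm => ?_⟩
      induction m, hm using Nat.le_induction with
      | base => rw [hg, memp p le_rfl]; exact Nat.zero_le _
      | succ m hm ih =>
        rw [hstep m hm]
        split_ifs with hs
        · have : (mem Stop p (pre g m)).1 ≠ n := fun h => hn _ (h ▸ hs)
          simp only; omega
        · exact ih
    have hmax : ∃ M, p.length ≤ M ∧ ∀ m, M ≤ m →
        (mem Stop p (pre g m)) = (mem Stop p (pre g M)) := by
      by_contra hcon
      push Not at hcon
      have hgrow : ∀ n, ∃ M, p.length ≤ M ∧ n ≤ (mem Stop p (pre g M)).1 := by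
        intro n
        induction n with
        | zero => exact ⟨p.length, le_rfl, Nat.zero_le _⟩
        | succ n ih =>
          obtain ⟨M, hM, hn⟩ := ih
          by_contra hno
          push Not at hno
          obtain ⟨m, hm, hne⟩ := hcon M hM
          apply hne
          clear hne
          induction m, hm using Nat.le_induction with
          | base => rfl
          | succ m hm ih2 =>
            have h3 := hno (m+1) (by omega)
            rw [hstep m (by omega)] at h3 ⊢
            split_ifs at h3 ⊢ with hs
            · rw [ih2] at h3; simp only at h3; omega
            · exact ih2
      obtain ⟨N, hN⟩ := hbdd
      obtain ⟨M, hM, h⟩ := hgrow (N+1)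
      have := hN M hM
      omega
    obtain ⟨M, hM, hc⟩ := hmax
    obtain ⟨k, hk, hkM, he, hl⟩ := hinv M hM
    have hσM := hσ M hM
    have hall : ∀ l, k ≤ l → mem Stop p (pre g l) = mem Stop p (pre g M) := by
      intro l h
      rcases le_total l M with h' | h'
      · exact hl l h h'
      · exact hc l h'
    refine (hS _ _ hσM.2.2.2.1 hσM.2.2.2.2).2.2.2 g ?_ ?_
    · rw [he, pre_len]
    · intro n hn
      rw [he, pre_len] at hn
      have := (hσ n (hk.trans hn)).2.2.1
      rwa [hall n hn] at this

theorem IW.mono {F : List X → Set (Set X)} {T : Set (List X)} {W W' : List X → Prop}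
    {p : List X} {A A' : Set (ℕ → X)} (h : IW F T W p A) (hW : ∀ q, W q → W' q)
    (hA : A ⊆ A') : IW F T W' p A' := by
  obtain ⟨σ, h1, h2, h3, h4⟩ := h
  refine ⟨σ, h1, h2, fun q hq => ?_, fun g a b => hA (h4 g a b)⟩
  obtain ⟨D, hD, hx⟩ := h3 q hq
  exact ⟨D, hD, fun x a b => (hx x a b).imp_right (hW _)⟩

theorem IW.mem {F : List X → Set (Set X)} {T : Set (List X)} {W : List X → Prop}
    {p : List X} {A : Set (ℕ → X)} (h : IW F T W p A) : p ∈ T := by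
  obtain ⟨σ, h1, h2, _⟩ := h
  exact h1 h2

theorem absorb {F : List X → Set (Set X)} {T : Set (List X)} {W : List X → Prop}
    {p : List X} {A : Set (ℕ → X)} (h : IW F T (fun q => IW F T W q A ∨ W q) p A) :
    IW F T W p A := by
  have := comp F T W A (fun n q => n = 0 ∧ IW F T W q A)
    (fun n q => (n = 0 ∧ q = p) ∨ (n ≠ 0 ∧ IW F T W q A)) ?_ ?_ p h.mem (Or.inl ⟨rfl, rfl⟩)
  · refine this.mono (fun _ h => h) ?_
    rintro g (hg | hg)
    · exact hg
    · obtain ⟨m, hm⟩ := hg 1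
      exact absurd hm.1 one_ne_zero
  · rintro n r hr (⟨rfl, rfl⟩ | ⟨hn, hw⟩)
    · exact h.mono (fun q hq => hq.imp_left fun h => ⟨rfl, h⟩) subset_rfl
    · exact hw.mono (fun q hq => Or.inr hq) subset_rfl
  · rintro n q hq ⟨rfl, h⟩
    exact Or.inr ⟨one_ne_zero, h⟩

/-- one-step version -/
theorem step {F : List X → Set (Set X)} {T : Set (List X)} {W : List X → Prop}
    {p : List X} {A : Set (ℕ → X)} (hp : p ∈ T)
    (h : ∃ D ∈ F p, ∀ x ∈ D, x :: p ∈ T → IW F T W (x :: p) A ∨ W (x :: p)) :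
    IW F T W p A := by
  apply absorb
  refine ⟨{p}, by simpa using hp, rfl, ?_, ?_⟩
  · rintro q rfl
    obtain ⟨D, hD, hx⟩ := h
    exact ⟨D, hD, fun x a b => Or.inr (hx x a b)⟩
  · intro g _ hσ
    have := congrArg List.length (hσ (p.length + 1) (by omega))
    simp [pre_len] at this

def NL (F : List X → Set (Set X)) (T : Set (List X)) (A : Set (ℕ → X)) : Set (List X) :=
  {q | q ∈ T ∧ ¬ IWin F T q A}

theorem NL_IIq (F : List X → Set (Set X)) (T : Set (List X)) (A : Set (ℕ → X)) :
    IIq F (NL F T A) := by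
  rintro q ⟨hq, hn⟩ D hD
  by_contra hc
  push Not at hc
  apply hn
  refine step hq ⟨D, hD, fun x hx hxT => Or.inl ?_⟩
  by_contra h
  exact hc x hx ⟨hxT, h⟩

theorem NL_not (F : List X → Set (Set X)) (T : Set (List X)) (A : Set (ℕ → X)) {q : List X}
    (hq : q ∈ NL F T A) : ¬ IWin F (NL F T A) q A := by
  rintro ⟨σ, h1, h2, h3, h4⟩
  apply hq.2
  apply absorb
  refine ⟨σ, fun r hr => (h1 hr).1, h2, fun r hr => ?_, h4⟩
  obtain ⟨D, hD, hx⟩ := h3 r hr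
  refine ⟨D, hD, fun x hxD hxT => ?_⟩
  by_cases h : IWin F T (x :: r) A
  · exact Or.inr (Or.inl h)
  · exact Or.inl ((hx x hxD ⟨hxT, h⟩).resolve_right id)

theorem normalize {F : List X → Set (Set X)} {T : Set (List X)} {W : List X → Prop}
    {p : List X} {A : Set (ℕ → X)} (h : IW F T W p A) :
    ∃ σ : Set (List X), σ ⊆ T ∧ p ∈ σ ∧
    (∀ q ∈ σ, ∃ D ∈ F q, ∀ x ∈ D, x :: q ∈ T → x :: q ∈ σ ∨ W (x :: q)) ∧
    (∀ g : ℕ → X, pre g p.length = p → (∀ n, p.length ≤ n → pre g n ∈ σ) → g ∈ A) ∧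
    (∀ q ∈ σ, p <:+ q ∧ ∀ s, p <:+ s → s <:+ q → s ∈ σ) := by
  obtain ⟨σ, h1, h2, h3, h4⟩ := h
  refine ⟨{q | p <:+ q ∧ ∀ s, p <:+ s → s <:+ q → s ∈ σ}, fun q hq => h1 (hq.2 q hq.1 List.suffix_rfl),
    ⟨List.suffix_rfl, fun s h h' => ?_⟩, fun q hq => ?_, fun g hg h => ?_, fun q hq => ⟨hq.1, fun s h h' => ⟨h, fun t ht ht' => hq.2 t ht (ht'.trans h')⟩⟩⟩
  · rwa [← h.eq_of_length_le h'.length_le]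
  · obtain ⟨D, hD, hx⟩ := h3 q (hq.2 q hq.1 List.suffix_rfl)
    refine ⟨D, hD, fun x hxD hxT => (hx x hxD hxT).imp_left fun h => ⟨hq.1.trans (List.suffix_cons _ _), fun s hs hs' => ?_⟩⟩
    rcases List.suffix_cons_iff.1 hs' with rfl | h'
    · exact h
    · exact hq.2 s hs h'
  · exact h4 g hg fun n hn => (h n hn).2 _ (h n hn).1 List.suffix_rfl


/-- switching memory -/
noncomputable def sw (R : List X → Prop) (r : List X) : List X → Option (List X)
  | [] => none
  | x :: q => if (x :: q).length ≤ r.length then none else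
      match sw R r q with
      | some q0 => some q0
      | none => if R (x :: q) then some (x :: q) else none

theorem sw_base (R : List X → Prop) (r q : List X) (h : q.length ≤ r.length) :
    sw R r q = none := by
  cases q with
  | nil => rfl
  | cons x q => rw [sw, if_pos h]

theorem sw_cons_some (R : List X → Prop) (r q q0 : List X) (x : X) (h : r.length ≤ q.length)
    (hs : sw R r q = some q0) : sw R r (x :: q) = some q0 := by
  rw [sw, if_neg (by simp; omega), hs]

theorem sw_cons_none (R : List X → Prop) (r q : List X) (x : X) (h : r.length ≤ q.length)
    (hs : sw R r q = none) : sw R r (x :: q) = if R (x :: q) then some (x :: q) else none := by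
  rw [sw, if_neg (by simp; omega), hs]

theorem sw_spec (R : List X → Prop) (r q q0 : List X) (h : sw R r q = some q0) :
    q0 <:+ q ∧ r.length < q0.length ∧ sw R r q0 = some q0 := by
  induction q with
  | nil => simp [sw] at h
  | cons x q ih =>
    by_cases hl : (x :: q).length ≤ r.length
    · rw [sw_base R r _ hl] at h; simp at h
    · have hl' : r.length ≤ q.length := by simp at hl; omega
      cases hq : sw R r q with
      | some q1 =>
        rw [sw_cons_some R r q q1 x hl' hq] at h
        obtain rfl : q1 = q0 := by simpa using h
        have := ih hq
        exact ⟨this.1.trans (List.suffix_cons _ _), this.2⟩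
      | none =>
        have h' := h
        rw [sw_cons_none R r q x hl' hq] at h
        split_ifs at h with hR
        obtain rfl : x :: q = q0 := by simpa using h
        exact ⟨List.suffix_rfl, by omega, h'⟩

theorem davis_lemma (F : List X → Set (Set X)) (T : Set (List X)) (A : Set (ℕ → X))
    (R : ℕ → List X → Prop) (hR : ∀ n q x, R n q → R n (x :: q))
    (hB : ∀ g, (∀ n, ∃ m, R n (pre g m)) → g ∈ A)
    (p : List X) (hp : p ∈ T) (hnw : ¬ IWin F T p A) :
    ∃ U ⊆ T, IIq F U ∧ p ∈ U ∧ ¬ IWin F U p A ∧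
      ∀ g, pre g p.length = p → (∀ n, p.length ≤ n → pre g n ∈ U) →
        ¬ ∀ n, ∃ m, R n (pre g m) := by
  set T' := NL F T A with hT'
  let Good : List X → Prop := fun q => ∃ U ⊆ T', IIq F U ∧ q ∈ U ∧ ¬ IWin F U q A ∧
      ∀ g, pre g q.length = q → (∀ n, q.length ≤ n → pre g n ∈ U) →
        ¬ ∀ n, ∃ m, R n (pre g m)
  by_contra hcon
  have hpT' : p ∈ T' := ⟨hp, hnw⟩
  have hbad : ¬ Good p := by
    rintro ⟨U, hU, h⟩
    exact hcon ⟨U, fun q hq => (hU hq).1, h⟩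
  let Stop : ℕ → List X → Prop := fun n q => ¬ Good q ∧ R n q
  have claim : ∀ n, ∀ r ∈ T', ¬ Good r → IW F T' (Stop n) r A := by
    intro n r hr hrb
    by_contra hno
    apply hrb
    have hch : ∀ q, ∃ U : Set (List X), Good q → (U ⊆ T' ∧ IIq F U ∧ q ∈ U ∧ ¬ IWin F U q A ∧
      ∀ g, pre g q.length = q → (∀ n, q.length ≤ n → pre g n ∈ U) →
        ¬ ∀ n, ∃ m, R n (pre g m)) := by
      intro q
      by_cases h : Good q
      · obtain ⟨U, hU⟩ := h
        exact ⟨U, fun _ => hU⟩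
      · exact ⟨∅, fun h' => absurd h' h⟩
    choose G hG using hch
    let U : Set (List X) := {q | r <:+ q ∧
      ((sw (R n) r q = none ∧ q ∈ T' ∧ ¬ IW F T' (Stop n) q A) ∨
       ∃ q0, sw (R n) r q = some q0 ∧ Good q0 ∧ q ∈ G q0)}
    -- entering a new position from an unswitched one
    have henter : ∀ q x, r <:+ q → sw (R n) r q = none → x :: q ∈ T' → ¬ Stop n (x :: q) →
        ¬ IW F T' (Stop n) (x :: q) A → x :: q ∈ U := by
      intro q x hrq hs hxT hxS hxI
      refine ⟨hrq.trans (List.suffix_cons _ _), ?_⟩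
      by_cases hRx : R n (x :: q)
      · right
        have hg : Good (x :: q) := by
          by_contra h
          exact hxS ⟨h, hRx⟩
        refine ⟨x :: q, ?_, hg, (hG _ hg).2.2.1⟩
        rw [sw_cons_none _ _ _ _ hrq.length_le hs, if_pos hRx]
      · left
        refine ⟨?_, hxT, hxI⟩
        rw [sw_cons_none _ _ _ _ hrq.length_le hs, if_neg hRx]
    refine ⟨U, ?_, ?_, ?_, ?_, ?_⟩
    · rintro q ⟨_, h | ⟨q0, _, hg, hq⟩⟩
      · exact h.2.1
      · exact (hG q0 hg).1 hq
    · rintro q ⟨hrq, ⟨hs, hqT, hqI⟩ | ⟨q0, hs, hg, hq⟩⟩ D hD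
      · by_contra hc
        push Not at hc
        apply hqI
        refine step hqT ⟨D, hD, fun x hx hxT => ?_⟩
        by_contra h
        push Not at h
        exact hc x hx (henter q x hrq hs hxT h.2 h.1)
      · obtain ⟨x, hx, hxG⟩ := (hG q0 hg).2.1 q hq D hD
        exact ⟨x, hx, hrq.trans (List.suffix_cons _ _), Or.inr ⟨q0,
          sw_cons_some _ _ _ _ _ hrq.length_le hs, hg, hxG⟩⟩
    · exact ⟨List.suffix_rfl, Or.inl ⟨sw_base _ _ _ le_rfl, hr, hno⟩⟩
    · intro hw
      obtain ⟨σ, h1, h2, h3, h4, h5⟩ := normalize hw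
      by_cases hsw : ∃ q ∈ σ, sw (R n) r q = some q
      · obtain ⟨q, hqσ, hqs⟩ := hsw
        obtain ⟨hrq, h | ⟨q0, hs, hg, hqG⟩⟩ := h1 hqσ
        · rw [h.1] at hqs; simp at hqs
        obtain rfl : q = q0 := by rw [hqs] at hs; simpa using hs
        apply (hG q hg).2.2.2.1
        refine ⟨{q' | q' ∈ σ ∧ q' ∈ G q ∧ sw (R n) r q' = some q}, fun q' h => h.2.1,
          ⟨hqσ, hqG, hqs⟩, ?_, ?_⟩
        · rintro q' ⟨ha, hb, hc⟩
          obtain ⟨D, hD, hx⟩ := h3 q' ha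
          refine ⟨D, hD, fun x hxD hxG => Or.inl ?_⟩
          have hs' := sw_cons_some _ _ _ _ x (h5 q' ha).1.length_le hc
          have : x :: q' ∈ U := ⟨(h5 q' ha).1.trans (List.suffix_cons _ _),
            Or.inr ⟨q, hs', hg, hxG⟩⟩
          exact ⟨(hx x hxD this).resolve_right id, hxG, hs'⟩
        · intro g hgq hgσ
          have hrg : r = pre g r.length := by
            rw [← hgq] at hrq
            exact suffix_pre g hrq
          refine h4 g hrg.symm fun k hk => ?_
          rcases le_total k q.length with h | h
          · refine (h5 q hqσ).2 _ ?_ ?_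
            · rw [hrg]; exact pre_suffix g hk
            · rw [← hgq]; exact pre_suffix g h
          · exact (hgσ k h).1
      · push Not at hsw
        have hnone : ∀ q ∈ σ, sw (R n) r q = none := by
          intro q hq
          cases hs : sw (R n) r q with
          | none => rfl
          | some q0 =>
            exfalso
            obtain ⟨ha, hb, hc⟩ := sw_spec _ _ _ _ hs
            refine hsw q0 ((h5 q hq).2 q0 ?_ ha) hc
            exact List.suffix_of_suffix_length_le (h5 q hq).1 ha hb.le
        apply hno
        apply absorb
        refine ⟨σ, ?_, h2, ?_, h4⟩
        · intro q hq
          obtain ⟨_, h | ⟨q0, hs, _⟩⟩ := h1 hq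
          · exact h.2.1
          · rw [hnone q hq] at hs; simp at hs
        · intro q hq
          obtain ⟨D, hD, hx⟩ := h3 q hq
          refine ⟨D, hD, fun x hxD hxT => ?_⟩
          by_contra h
          push Not at h
          have := henter q x (h5 q hq).1 (hnone q hq) hxT h.2.2 h.2.1
          exact h.1 ((hx x hxD this).resolve_right id)
    · intro g hgr hgU hall
      obtain ⟨m, hm⟩ := hall n
      have hmono : ∀ k, m ≤ k → R n (pre g k) := by
        intro k hk
        induction k, hk using Nat.le_induction with
        | base => exact hm
        | succ k _ ih => exact hR _ _ _ ih
      -- eventually switched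
      have hsome : ∃ k, r.length ≤ k ∧ ∃ q0, sw (R n) r (pre g k) = some q0 := by
        set k := max m r.length with hk
        cases hs : sw (R n) r (pre g k) with
        | some q0 => exact ⟨k, le_max_right _ _, q0, hs⟩
        | none =>
          refine ⟨k + 1, by omega, pre g (k+1), ?_⟩
          rw [pre, sw_cons_none _ _ _ _ (by rw [pre_len]; omega) hs, if_pos]
          exact hmono (k+1) (by omega)
      obtain ⟨k, hk, q0, hs⟩ := hsome
      obtain ⟨ha, hb, hc⟩ := sw_spec _ _ _ _ hs
      have hq0 := suffix_pre g ha
      have hs' : ∀ l, q0.length ≤ l → sw (R n) r (pre g l) = some q0 := by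
        intro l hl
        induction l, hl using Nat.le_induction with
        | base => rw [← hq0]; exact hc
        | succ l hl ih => exact sw_cons_some _ _ _ _ _ (by rw [pre_len]; omega) ih
      have hUl : ∀ l, q0.length ≤ l → Good q0 ∧ pre g l ∈ G q0 := by
        intro l hl
        obtain ⟨_, h | ⟨q1, hs1, hg1, hq1⟩⟩ := hgU l (by omega)
        · rw [hs' l hl] at h; simp at h
        · rw [hs' l hl] at hs1
          obtain rfl : q0 = q1 := by simpa using hs1
          exact ⟨hg1, hq1⟩
      exact (hG q0 (hUl _ le_rfl).1).2.2.2.2 g hq0.symm (fun l hl => (hUl l hl).2) hall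
  have hwin := comp F T' (fun _ => False) A Stop (fun _ q => ¬ Good q)
    (fun n r hr hb => (claim n r hr hb).mono (fun q h => Or.inl h) subset_rfl)
    (fun n q _ h => h.1) p hpT' hbad
  refine NL_not F T A hpT' (hwin.mono (fun _ h => h) ?_)
  rintro g (hg | hg)
  · exact hg
  · exact hB g fun n => (hg n).imp fun m h => h.2

theorem davis (F : List X → Set (Set X)) (A : Set (ℕ → X))
    (R : ℕ → ℕ → List X → Prop) (hR : ∀ k n q x, R k n q → R k n (x :: q))
    (hA : ∀ g, g ∈ A ↔ ∃ k, ∀ n, ∃ m, R k n (pre g m))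
    (hnw : ¬ IWin F Set.univ [] A) :
    ∃ U : Set (List X), IIq F U ∧ [] ∈ U ∧ ∀ g, (∀ n, pre g n ∈ U) → g ∉ A := by
  have hl : ∀ (T : Set (List X)) (k : ℕ) (p : List X), ∃ U ⊆ T, p ∈ T → ¬ IWin F T p A →
      IIq F U ∧ p ∈ U ∧ ¬ IWin F U p A ∧
      ∀ g, pre g p.length = p → (∀ n, p.length ≤ n → pre g n ∈ U) →
        ¬ ∀ n, ∃ m, R k n (pre g m) := by
    intro T k p
    by_cases h : p ∈ T ∧ ¬ IWin F T p A
    · obtain ⟨U, hU, h'⟩ := davis_lemma F T A (R k) (hR k) (fun g hg => (hA g).2 ⟨k, hg⟩) p h.1 h.2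
      exact ⟨U, hU, fun _ _ => h'⟩
    · exact ⟨T, subset_rfl, fun a b => absurd ⟨a, b⟩ h⟩
  choose L hLs hL using hl
  let U : List X → Set (List X) := fun q => List.rec (L Set.univ 0 [])
    (fun x q Uq => L Uq (q.length + 1) (x :: q)) q
  have hU0 : U [] = L Set.univ 0 [] := rfl
  have hU1 : ∀ x q, U (x :: q) = L (U q) (q.length + 1) (x :: q) := fun _ _ => rfl
  let P : List X → Prop := fun q => IIq F (U q) ∧ q ∈ U q ∧ ¬ IWin F (U q) q A ∧
      ∀ g, pre g q.length = q → (∀ n, q.length ≤ n → pre g n ∈ U q) →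
        ¬ ∀ n, ∃ m, R q.length n (pre g m)
  refine ⟨{q | P q}, ?_, hL Set.univ 0 [] (Set.mem_univ _) hnw, ?_⟩
  · rintro q ⟨h1, h2, h3, h4⟩ D hD
    obtain ⟨x, hx, hxN⟩ := NL_IIq F (U q) A q ⟨h2, h3⟩ D hD
    exact ⟨x, hx, hL (U q) (q.length + 1) (x :: q) hxN.1 hxN.2⟩
  · intro g hg hgA
    obtain ⟨k, hk⟩ := (hA g).1 hgA
    have hanti : ∀ n, k ≤ n → U (pre g n) ⊆ U (pre g k) := by
      intro n hn
      induction n, hn using Nat.le_induction with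
      | base => exact subset_rfl
      | succ n _ ih =>
        refine subset_trans ?_ ih
        exact hLs _ _ _
    have hPk := (hg k).2.2.2 g (by rw [pre_len]) (fun n hn => hanti n (by rwa [pre_len] at hn) (hg n).2.1)
    rw [pre_len] at hPk
    exact hPk hk

end DV

namespace DV

section top
variable {X : Type} [TopologicalSpace X] [DiscreteTopology X]

theorem pre_eq {g h : ℕ → X} {m : ℕ} (e : pre h m = pre g m) : ∀ i < m, h i = g i := by
  induction m with
  | zero => intro i hi; omega
  | succ m ih =>
    rw [pre, pre, List.cons.injEq] at e
    intro i hi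
    rcases Nat.lt_or_ge i m with h' | h'
    · exact ih e.2 i h'
    · rw [show i = m by omega]; exact e.1

theorem open_pre {D : Set (ℕ → X)} (hD : IsOpen D) {g : ℕ → X} (hg : g ∈ D) :
    ∃ m, ∀ h, pre h m = pre g m → h ∈ D := by
  obtain ⟨s, ⟨x, n, rfl⟩, hgs, hs⟩ :=
    (PiNat.isTopologicalBasis_cylinders (fun _ : ℕ => X)).exists_subset_of_mem_open hg hD
  refine ⟨n, fun h e => hs ?_⟩
  rw [PiNat.mem_cylinder_iff] at hgs ⊢
  intro i hi
  rw [pre_eq e i hi, hgs i hi]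

/-- countable unions of Gδ sets -/
def Sig3 (A : Set (ℕ → X)) : Prop := ∃ B : ℕ → Set (ℕ → X), (∀ k, IsGδ (B k)) ∧ A = ⋃ k, B k

theorem davis_top (F : List X → Set (Set X)) (A : Set (ℕ → X)) (hA : Sig3 A)
    (hnw : ¬ IWin F Set.univ [] A) :
    ∃ U : Set (List X), IIq F U ∧ [] ∈ U ∧ ∀ g, (∀ n, pre g n ∈ U) → g ∉ A := by
  obtain ⟨B, hB, rfl⟩ := hA
  choose D hDo hD using fun k => (hB k).eq_iInter_nat
  refine davis F _ (fun k n q => ∀ g, pre g q.length = q → g ∈ D k n) ?_ ?_ hnw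
  · intro k n q x h g hg
    apply h g
    rw [List.length_cons, pre, List.cons.injEq] at hg
    exact hg.2
  · intro g
    simp only [Set.mem_iUnion, hD, Set.mem_iInter]
    refine exists_congr fun k => forall_congr' fun n => ⟨fun h => ?_, ?_⟩
    · obtain ⟨m, hm⟩ := open_pre (hDo k n) h
      exact ⟨m, fun h hh => hm h (by rwa [pre_len] at hh)⟩
    · rintro ⟨m, hm⟩
      exact hm g (by rw [pre_len])

theorem closed_gdelta {D : Set (ℕ → X)} (hD : IsClosed D) : IsGδ D := hD.isGδ

/-- both Gδ and Fσ -/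
def Del2 (A : Set (ℕ → X)) : Prop := IsGδ A ∧ IsGδ Aᶜ

theorem Del2.of_open {A : Set (ℕ → X)} (h : IsOpen A) : Del2 A :=
  ⟨h.isGδ, closed_gdelta h.isClosed_compl⟩

theorem Del2.compl {A : Set (ℕ → X)} (h : Del2 A) : Del2 Aᶜ := ⟨h.2, by rw [compl_compl]; exact h.1⟩

theorem Del2.union {A B : Set (ℕ → X)} (h : Del2 A) (h' : Del2 B) : Del2 (A ∪ B) :=
  ⟨h.1.union h'.1, by rw [Set.compl_union]; exact h.2.inter h'.2⟩

theorem Del2.inter {A B : Set (ℕ → X)} (h : Del2 A) (h' : Del2 B) : Del2 (A ∩ B) :=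
  ⟨h.1.inter h'.1, by rw [Set.compl_inter]; exact h.2.union h'.2⟩

theorem Del2.const (P : Prop) : Del2 {_g : ℕ → X | P} := by
  apply Del2.of_open
  exact isOpen_const

theorem Del2.ball {A : ℕ → Set (ℕ → X)} (h : ∀ i, Del2 (A i)) (P : ℕ → Prop) (n : ℕ) :
    Del2 {g | ∀ i < n, P i → g ∈ A i} := by
  induction n with
  | zero => simpa using Del2.const (X := X) True
  | succ n ih =>
    have : {g | ∀ i < n + 1, P i → g ∈ A i} = {g | ∀ i < n, P i → g ∈ A i} ∩
        ({_g | ¬ P n} ∪ A n) := by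
      ext g
      constructor
      · intro hg
        refine ⟨fun i hi => hg i (by omega), ?_⟩
        by_cases hP : P n
        · exact Or.inr (hg n (by omega) hP)
        · exact Or.inl hP
      · rintro ⟨h1, h2⟩ i hi hP
        rcases Nat.lt_or_ge i n with h' | h'
        · exact h1 i h' hP
        · obtain rfl : i = n := by omega
          exact h2.resolve_left (fun h => h hP)
    rw [this]
    exact ih.inter ((Del2.const _).union (h n))

theorem Del2.bex {A : ℕ → Set (ℕ → X)} (h : ∀ i, Del2 (A i)) (n : ℕ) :
    Del2 {g | ∃ i < n, g ∈ A i} := by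
  have := (Del2.ball (fun i => (h i).compl) (fun _ => True) n).compl
  convert this using 1
  ext g
  simp

end top

section ltl
open ATLs
variable {AP Ag S : Type} (lab : S → Set (AP ⊕ ATLs AP Ag))

/-- positional truth -/
def tr (π : ℕ → S) : ATLs AP Ag → ℕ → Prop
  | .tt, _ => True
  | .atom p, k => Sum.inl p ∈ lab (π k)
  | .neg φ, k => ¬ tr π φ k
  | .or φ ψ, k => tr π φ k ∨ tr π ψ k
  | .next φ, k => tr π φ (k + 1)
  | .untl φ ψ, k => ∃ j, k ≤ j ∧ tr π ψ j ∧ ∀ l, k ≤ l → l < j → tr π φ l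
  | .coal A φ, k => Sum.inr (coal A φ) ∈ lab (π k)

theorem tr_iff (π : ℕ → S) (φ : ATLs AP Ag) (k : ℕ) :
    ltlSat (fun i => lab (π (i + k))) φ ↔ tr lab π φ k := by
  induction φ generalizing k with
  | tt => simp [ltlSat, tr]
  | atom p => simp [ltlSat, tr]
  | neg φ ih => simp [ltlSat, tr, ih]
  | or φ ψ ih1 ih2 => simp [ltlSat, tr, ih1, ih2]
  | next φ ih =>
    simp only [ltlSat, tr, ← ih]
    have : ∀ i, i + 1 + k = i + (k + 1) := by intro i; omega
    simp only [this]
  | untl φ ψ ih1 ih2 =>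
    simp only [ltlSat, tr]
    have : ∀ i j, i + j + k = i + (j + k) := by intro i j; omega
    simp only [this, ih1, ih2]
    constructor
    · rintro ⟨j, h1, h2⟩
      refine ⟨j + k, by omega, h1, fun l hl hl' => ?_⟩
      have := h2 (l - k) (by omega)
      rwa [show l - k + k = l by omega] at this
    · rintro ⟨j, hj, h1, h2⟩
      refine ⟨j - k, by rwa [show j - k + k = j by omega], fun l hl => h2 _ (by omega) (by omega)⟩
  | coal A φ _ => simp [ltlSat, tr]

/-- open (`true`) and closed (`false`) approximations relative to a guess `M` -/
def ap (M : Set (ATLs AP Ag)) (π : ℕ → S) : ATLs AP Ag → Bool → ℕ → Prop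
  | .tt, _, _ => True
  | .atom p, _, k => Sum.inl p ∈ lab (π k)
  | .neg φ, b, k => ¬ ap M π φ (!b) k
  | .or φ ψ, b, k => ap M π φ b k ∨ ap M π ψ b k
  | .next φ, b, k => ap M π φ b (k + 1)
  | .untl φ ψ, true, k => ∃ j, k ≤ j ∧ ap M π ψ true j ∧ ∀ l, k ≤ l → l < j → ap M π φ true l
  | .untl φ ψ, false, k => untl φ ψ ∈ M ∧
      ∀ j, k ≤ j → ap M π φ false j ∨ ∃ l, l < j + 1 ∧ k ≤ l ∧ ap M π ψ false l
  | .coal A φ, _, k => Sum.inr (coal A φ) ∈ lab (π k)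

theorem atom_clopen [TopologicalSpace S] [DiscreteTopology S] (P : S → Prop) (k : ℕ) :
    IsClopen {π : ℕ → S | P (π k)} :=
  (isClopen_discrete {s | P s}).preimage (continuous_apply k)

theorem isOpen_ballp {X : Type} [TopologicalSpace X] (A : ℕ → Set X) (h : ∀ i, IsOpen (A i))
    (k n : ℕ) : IsOpen {g | ∀ i, k ≤ i → i < n → g ∈ A i} := by
  have : {g | ∀ i, k ≤ i → i < n → g ∈ A i} = ⋂ i ∈ Set.Ico k n, A i := by
    ext g; simp
  rw [this]
  exact (Set.finite_Ico k n).isOpen_biInter fun i _ => h i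

theorem ap_top [TopologicalSpace S] [DiscreteTopology S] (M : Set (ATLs AP Ag)) (φ : ATLs AP Ag)
    (k : ℕ) : IsOpen {π | ap lab M π φ true k} ∧ IsClosed {π | ap lab M π φ false k} := by
  induction φ generalizing k with
  | tt => simp [ap]
  | atom p =>
    have := atom_clopen (fun s => Sum.inl p ∈ lab s) k
    exact ⟨this.isOpen, this.isClosed⟩
  | neg φ ih =>
    exact ⟨(ih k).2.isOpen_compl, (ih k).1.isClosed_compl⟩
  | or φ ψ ih1 ih2 => exact ⟨(ih1 k).1.union (ih2 k).1, (ih1 k).2.union (ih2 k).2⟩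
  | next φ ih => exact ih (k + 1)
  | untl φ ψ ih1 ih2 =>
    constructor
    · simp only [ap]
      rw [show {π | ∃ j, k ≤ j ∧ ap lab M π ψ true j ∧ ∀ l, k ≤ l → l < j → ap lab M π φ true l} =
        ⋃ j, ⋃ (_ : k ≤ j), {π | ap lab M π ψ true j} ∩
          {π | ∀ l, k ≤ l → l < j → π ∈ {π | ap lab M π φ true l}} by
          ext π
          simp only [Set.mem_ofPred_eq, Set.mem_iUnion, Set.mem_inter_iff, exists_prop]]
      exact isOpen_iUnion fun j => isOpen_iUnion fun _ =>
        (ih2 j).1.inter (isOpen_ballp _ (fun l => (ih1 l).1) k j)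
    · rw [← isOpen_compl_iff]
      have : {π | ap lab M π (.untl φ ψ) false k}ᶜ = {_π | untl φ ψ ∉ M} ∪
        ⋃ j, ⋃ (_ : k ≤ j), {π | ap lab M π φ false j}ᶜ ∩
          {π | ∀ l, k ≤ l → l < j + 1 → π ∈ {π | ap lab M π ψ false l}ᶜ} := by
        ext π
        simp only [ap, Set.mem_compl_iff, Set.mem_ofPred_eq, Set.mem_union, Set.mem_iUnion, Set.mem_inter_iff]
        grind
      rw [this]
      exact isOpen_const.union (isOpen_iUnion fun j => isOpen_iUnion fun _ =>
        (ih1 j).2.isOpen_compl.inter (isOpen_ballp _ (fun l => (ih2 l).2.isOpen_compl) k (j+1)))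
  | coal A φ _ =>
    have := atom_clopen (fun s => Sum.inr (coal A φ) ∈ lab s) k
    exact ⟨this.isOpen, this.isClosed⟩

theorem subf_self (φ : ATLs AP Ag) : φ ∈ subf φ := by cases φ <;> simp [subf]

theorem subf_trans {φ ψ : ATLs AP Ag} (h : ψ ∈ subf φ) : subf ψ ⊆ subf φ := by
  induction φ with
  | tt => simp only [subf, Set.mem_singleton_iff] at h; rw [h]
  | atom p => simp only [subf, Set.mem_singleton_iff] at h; rw [h]
  | neg φ ih =>
    rcases h with rfl | h
    · rfl
    · exact (ih h).trans (Set.subset_insert _ _)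
  | or φ χ ih1 ih2 =>
    rcases h with rfl | h | h
    · rfl
    · exact (ih1 h).trans (Set.subset_union_left.trans (Set.subset_insert _ _))
    · exact (ih2 h).trans (Set.subset_union_right.trans (Set.subset_insert _ _))
  | next φ ih =>
    rcases h with rfl | h
    · rfl
    · exact (ih h).trans (Set.subset_insert _ _)
  | untl φ χ ih1 ih2 =>
    rcases h with rfl | h | h
    · rfl
    · exact (ih1 h).trans (Set.subset_union_left.trans (Set.subset_insert _ _))
    · exact (ih2 h).trans (Set.subset_union_right.trans (Set.subset_insert _ _))
  | coal A φ ih =>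
    rcases h with rfl | h
    · rfl
    · exact (ih h).trans (Set.subset_insert _ _)

theorem subf_finite (φ : ATLs AP Ag) : (subf φ).Finite := by
  induction φ with
  | tt => exact Set.finite_singleton _
  | atom p => exact Set.finite_singleton _
  | neg φ ih => exact ih.insert _
  | or φ χ ih1 ih2 => exact (ih1.union ih2).insert _
  | next φ ih => exact ih.insert _
  | untl φ χ ih1 ih2 => exact (ih1.union ih2).insert _
  | coal A φ ih => exact ih.insert _

/-- infinitely often -/
def GF (P : ℕ → Prop) : Prop := ∀ i, ∃ j, i ≤ j ∧ P j

theorem ap_exact (M : Set (ATLs AP Ag)) (π : ℕ → S) (χ : ATLs AP Ag)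
    (H : ∀ a c, untl a c ∈ subf χ → ((untl a c ∈ M ↔ GF (ap lab M π (.untl a c) true)) ∨
      (untl a c ∈ M ↔ GF (tr lab π (.untl a c))))) :
    ∃ i, ∀ b, ∀ j, i ≤ j → (ap lab M π χ b j ↔ tr lab π χ j) := by
  induction χ with
  | tt => exact ⟨0, by simp [ap, tr]⟩
  | atom p => exact ⟨0, by simp [ap, tr]⟩
  | coal A φ _ => exact ⟨0, by simp [ap, tr]⟩
  | neg φ ih =>
    obtain ⟨i, hi⟩ := ih fun a c h => H a c (Or.inr h)
    exact ⟨i, fun b j hj => by simp only [ap, tr]; rw [hi (!b) j hj]⟩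
  | or φ ψ ih1 ih2 =>
    obtain ⟨i, hi⟩ := ih1 fun a c h => H a c (Or.inr (Or.inl h))
    obtain ⟨i', hi'⟩ := ih2 fun a c h => H a c (Or.inr (Or.inr h))
    refine ⟨max i i', fun b j hj => ?_⟩
    simp only [ap, tr]
    rw [hi b j (by omega), hi' b j (by omega)]
  | next φ ih =>
    obtain ⟨i, hi⟩ := ih fun a c h => H a c (Or.inr h)
    exact ⟨i, fun b j hj => by simp only [ap, tr]; rw [hi b (j+1) (by omega)]⟩
  | untl φ ψ ih1 ih2 =>
    obtain ⟨i1, hi1⟩ := ih1 fun a c h => H a c (Or.inr (Or.inl h))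
    obtain ⟨i2, hi2⟩ := ih2 fun a c h => H a c (Or.inr (Or.inr h))
    have hO : ∀ j, max i1 i2 ≤ j →
        (ap lab M π (.untl φ ψ) true j ↔ tr lab π (.untl φ ψ) j) := by
      intro j hj
      simp only [ap, tr]
      refine exists_congr fun k => and_congr_right fun hk => and_congr (hi2 _ _ (by omega)) ?_
      exact forall_congr' fun l => forall_congr' fun hl => forall_congr' fun _ => hi1 _ _ (by omega)
    have hM : untl φ ψ ∈ M ↔ GF (tr lab π (.untl φ ψ)) := by
      rcases H φ ψ (subf_self _) with h | h
      · rw [h]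
        constructor <;> intro hg i <;> obtain ⟨j, hj, h'⟩ := hg (max i (max i1 i2))
        · exact ⟨j, by omega, (hO j (by omega)).1 h'⟩
        · exact ⟨j, by omega, (hO j (by omega)).2 h'⟩
      · exact h
    by_cases hm : untl φ ψ ∈ M
    · refine ⟨max i1 i2, fun b j hj => ?_⟩
      cases b with
      | true => exact hO j hj
      | false =>
        simp only [ap, hm, true_and]
        have e : (∀ k, j ≤ k → ap lab M π φ false k ∨ ∃ l, l < k + 1 ∧ j ≤ l ∧ ap lab M π ψ false l) ↔
            (∀ k, j ≤ k → tr lab π φ k ∨ ∃ l, l < k + 1 ∧ j ≤ l ∧ tr lab π ψ l) := by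
          refine forall_congr' fun k => forall_congr' fun hk => or_congr (hi1 _ _ (by omega)) ?_
          exact exists_congr fun l => and_congr_right fun _ => and_congr_right fun _ =>
            hi2 _ _ (by omega)
        rw [e]
        constructor
        · intro hw
          obtain ⟨k, hk, k', hk', hψ, _⟩ := hM.1 hm j
          have hex : ∃ k, j ≤ k ∧ tr lab π ψ k := ⟨k', by omega, hψ⟩
          refine ⟨Nat.find hex, (Nat.find_spec hex).1, (Nat.find_spec hex).2, fun l hl hl' => ?_⟩
          rcases hw l hl with h | ⟨m, hm1, hm2, hm3⟩
          · exact h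
          · exact absurd ⟨hm2, hm3⟩ (Nat.find_min hex (by omega))
        · rintro ⟨k, hk, hψ, hφ⟩ l hl
          rcases Nat.lt_or_ge l k with h | h
          · exact Or.inl (hφ l hl h)
          · exact Or.inr ⟨k, by omega, hk, hψ⟩
    · have hm' := mt hM.2 hm
      unfold GF at hm'
      push Not at hm'
      obtain ⟨i3, hi3⟩ := hm'
      refine ⟨max i3 (max i1 i2), fun b j hj => ?_⟩
      cases b with
      | true => exact hO j (by omega)
      | false =>
        constructor
        · intro h
          exact absurd h.1 hm
        · intro h
          exact absurd h (hi3 j (by omega))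

/-- evaluation with cutoff `i` -/
def ev (M : Set (ATLs AP Ag)) (i : ℕ) (π : ℕ → S) : ATLs AP Ag → ℕ → Prop
  | .tt, _ => True
  | .atom p, k => Sum.inl p ∈ lab (π k)
  | .neg φ, k => ¬ ev M i π φ k
  | .or φ ψ, k => ev M i π φ k ∨ ev M i π ψ k
  | .next φ, k => ev M i π φ (k + 1)
  | .untl φ ψ, k => (∃ j < i, k ≤ j ∧ ev M i π ψ j ∧ ∀ l < j, k ≤ l → ev M i π φ l) ∨
      ((∀ l < i, k ≤ l → ev M i π φ l) ∧ ap lab M π (.untl φ ψ) true (max i k))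
  | .coal A φ, k => Sum.inr (coal A φ) ∈ lab (π k)

theorem ev_top [TopologicalSpace S] [DiscreteTopology S] (M : Set (ATLs AP Ag)) (i : ℕ)
    (φ : ATLs AP Ag) (k : ℕ) : Del2 {π | ev lab M i π φ k} := by
  induction φ generalizing k with
  | tt => exact Del2.const _
  | atom p => exact Del2.of_open (atom_clopen (fun s => Sum.inl p ∈ lab s) k).isOpen
  | neg φ ih => exact (ih k).compl
  | or φ ψ ih1 ih2 => exact (ih1 k).union (ih2 k)
  | next φ ih => exact ih (k + 1)
  | untl φ ψ ih1 ih2 =>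
    refine Del2.union ?_ (Del2.inter ?_ (Del2.of_open (ap_top lab M (.untl φ ψ) (max i k)).1))
    · exact Del2.bex (fun j => (Del2.const (k ≤ j)).inter
        ((ih2 j).inter (Del2.ball ih1 (fun l => k ≤ l) j))) i
    · exact Del2.ball ih1 (fun l => k ≤ l) i
  | coal A φ _ => exact Del2.of_open (atom_clopen (fun s => Sum.inr (coal A φ) ∈ lab s) k).isOpen

theorem ev_exact (M : Set (ATLs AP Ag)) (i : ℕ) (π : ℕ → S) (χ : ATLs AP Ag)
    (H : ∀ a c, untl a c ∈ subf χ → ∀ j, i ≤ j →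
      (ap lab M π (.untl a c) true j ↔ tr lab π (.untl a c) j)) (k : ℕ) :
    ev lab M i π χ k ↔ tr lab π χ k := by
  induction χ generalizing k with
  | tt => simp [ev, tr]
  | atom p => simp [ev, tr]
  | coal A φ _ => simp [ev, tr]
  | neg φ ih =>
    simp only [ev, tr, ih fun a c h => H a c (Or.inr h)]
  | or φ ψ ih1 ih2 =>
    simp only [ev, tr, ih1 fun a c h => H a c (Or.inr (Or.inl h)),
      ih2 fun a c h => H a c (Or.inr (Or.inr h))]
  | next φ ih =>
    simp only [ev, tr, ih fun a c h => H a c (Or.inr h)]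
  | untl φ ψ ih1 ih2 =>
    simp only [ev, ih1 fun a c h => H a c (Or.inr (Or.inl h)),
      ih2 fun a c h => H a c (Or.inr (Or.inr h)), H φ ψ (subf_self _) (max i k) (le_max_left _ _)]
    simp only [tr]
    constructor
    · rintro (⟨j, _, hk, hψ, h⟩ | ⟨h1, j, hj, hψ, h⟩)
      · exact ⟨j, hk, hψ, fun l a b => h l b a⟩
      · refine ⟨j, by omega, hψ, fun l a b => ?_⟩
        rcases Nat.lt_or_ge l i with h' | h'
        · exact h1 l h' a
        · exact h l (by omega) b
    · rintro ⟨j, hk, hψ, h⟩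
      rcases Nat.lt_or_ge j i with h' | h'
      · exact Or.inl ⟨j, h', hk, hψ, fun l a b => h l b a⟩
      · exact Or.inr ⟨fun l a b => h l b (by omega), j, by omega, hψ, fun l a b => h l (by omega) b⟩

theorem exact_all (M : Set (ATLs AP Ag)) (π : ℕ → S) (φ : ATLs AP Ag)
    (H : ∀ a c, untl a c ∈ subf φ → ((untl a c ∈ M ↔ GF (ap lab M π (.untl a c) true)) ∨
      (untl a c ∈ M ↔ GF (tr lab π (.untl a c))))) :
    ∃ i, ∀ χ ∈ subf φ, ∀ b, ∀ j, i ≤ j → (ap lab M π χ b j ↔ tr lab π χ j) := by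
  have h1 : ∀ χ, ∃ i, χ ∈ subf φ → ∀ b, ∀ j, i ≤ j → (ap lab M π χ b j ↔ tr lab π χ j) := by
    intro χ
    by_cases h : χ ∈ subf φ
    · obtain ⟨i, hi⟩ := ap_exact lab M π χ fun a c h' => H a c (subf_trans h h')
      exact ⟨i, fun _ => hi⟩
    · exact ⟨0, fun h' => absurd h' h⟩
  choose f hf using h1
  obtain ⟨N, hN⟩ := ((subf_finite φ).image f).bddAbove
  exact ⟨N, fun χ hχ b j hj => hf χ hχ b j ((hN ⟨χ, hχ, rfl⟩).trans hj)⟩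

/-- the pieces of the decomposition -/
def piece (φ : ATLs AP Ag) (M : Set (ATLs AP Ag)) (i0 : ℕ) : Set (ℕ → S) :=
  {π | (∀ u ∈ subf φ, u ∈ M → GF (ap lab M π u true)) ∧
    (∀ u ∈ subf φ, u ∉ M → (∃ a c, u = untl a c) → ∀ j, i0 ≤ j → ¬ ap lab M π u true j) ∧
    ∀ i, i0 ≤ i → ev lab M i π φ 0}

theorem tr_piece (φ : ATLs AP Ag) (π : ℕ → S) :
    tr lab π φ 0 ↔ ∃ M ⊆ subf φ, ∃ i0, π ∈ piece lab φ M i0 := by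
  constructor
  · intro h
    set M : Set (ATLs AP Ag) := {u | u ∈ subf φ ∧ (∃ a c, u = untl a c) ∧ GF (tr lab π u)} with hM
    have hMu : ∀ a c, untl a c ∈ subf φ → (untl a c ∈ M ↔ GF (tr lab π (.untl a c))) :=
      fun a c h => ⟨fun h' => h'.2.2, fun h' => ⟨h, ⟨a, c, rfl⟩, h'⟩⟩
    obtain ⟨N, hN⟩ := exact_all lab M π φ fun a c h => Or.inr (hMu a c h)
    have hfin : ∀ u, ∃ i, u ∈ subf φ → u ∉ M → (∃ a c, u = untl a c) →
        ∀ j, i ≤ j → ¬ tr lab π u j := by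
      intro u
      by_cases hg : GF (tr lab π u)
      · exact ⟨0, fun h1 h2 h3 => absurd ⟨h1, h3, hg⟩ h2⟩
      · unfold GF at hg
        push Not at hg
        obtain ⟨i, hi⟩ := hg
        exact ⟨i, fun _ _ _ => hi⟩
    choose f hf using hfin
    obtain ⟨N', hN'⟩ := ((subf_finite φ).image f).bddAbove
    refine ⟨M, fun u hu => hu.1, max N N', ?_, ?_, ?_⟩
    · intro u hu hm i
      obtain ⟨j, hj, h'⟩ := hm.2.2 (max i N)
      exact ⟨j, by omega, (hN u hu true j (by omega)).2 h'⟩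
    · intro u hu hm hh j hj
      rw [hN u hu true j (by omega)]
      have : f u ≤ N' := hN' ⟨u, hu, rfl⟩
      exact hf u hu hm hh j (by omega)
    · intro i hi
      rw [ev_exact lab M i π φ fun a c h' j hj => hN _ h' true j (by omega)]
      exact h
  · rintro ⟨M, -, i0, h1, h2, h3⟩
    obtain ⟨N, hN⟩ := exact_all lab M π φ fun a c h => Or.inl ⟨h1 _ h, fun hg => by
      by_contra hm
      obtain ⟨j, hj, h'⟩ := hg i0
      exact h2 _ h hm ⟨a, c, rfl⟩ j hj h'⟩
    rw [← ev_exact lab M (max i0 N) π φ fun a c h' j hj => hN _ h' true j (by omega)]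
    exact h3 _ (le_max_left _ _)

theorem piece_gdelta [TopologicalSpace S] [DiscreteTopology S] (φ : ATLs AP Ag)
    (M : Set (ATLs AP Ag)) (i0 : ℕ) : IsGδ (piece (S := S) lab φ M i0) := by
  have hc := (subf_finite φ).countable
  have e : piece (S := S) lab φ M i0 =
      (⋂ u ∈ subf φ, ⋂ (_ : u ∈ M), ⋂ i : ℕ, ⋃ j : ℕ, ⋃ (_ : i ≤ j), {π | ap lab M π u true j}) ∩
      ((⋂ u ∈ subf φ, ⋂ (_ : u ∉ M), ⋂ (_ : ∃ a c, u = untl a c), ⋂ j : ℕ, ⋂ (_ : i0 ≤ j),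
        {π | ap lab M π u true j}ᶜ) ∩ ⋂ i : ℕ, ⋂ (_ : i0 ≤ i), {π | ev lab M i π φ 0}) := by
    ext π
    simp only [piece, GF, Set.mem_ofPred_eq, Set.mem_inter_iff, Set.mem_iInter, Set.mem_iUnion,
      Set.mem_compl_iff, exists_prop]
  rw [e]
  refine IsGδ.inter ?_ (IsGδ.inter ?_ ?_)
  · refine IsGδ.biInter hc fun u _ => IsGδ.iInter fun _ => IsGδ.iInter fun i => IsOpen.isGδ ?_
    exact isOpen_iUnion fun j => isOpen_iUnion fun _ => (ap_top lab M u j).1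
  · refine IsGδ.biInter hc fun u _ => IsGδ.iInter fun _ => IsGδ.iInter fun _ =>
      IsGδ.iInter fun j => IsGδ.iInter fun _ => closed_gdelta (ap_top lab M u j).1.isClosed_compl
  · exact IsGδ.iInter fun i => IsGδ.iInter fun _ => (ev_top lab M i φ 0).1

theorem ltl_sig3 [TopologicalSpace S] [DiscreteTopology S] (φ : ATLs AP Ag) :
    Sig3 {π : ℕ → S | ltlSat (fun i => lab (π i)) φ} := by
  have hfin : Finite {M : Set (ATLs AP Ag) // M ⊆ subf φ} :=
    (subf_finite φ).finite_subsets
  have : Nonempty ({M : Set (ATLs AP Ag) // M ⊆ subf φ} × ℕ) := ⟨⟨⟨∅, Set.empty_subset _⟩, 0⟩⟩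
  obtain ⟨f, hf⟩ := exists_surjective_nat ({M : Set (ATLs AP Ag) // M ⊆ subf φ} × ℕ)
  refine ⟨fun k => piece lab φ (f k).1.1 (f k).2, fun k => piece_gdelta lab φ _ _, ?_⟩
  ext π
  have := tr_iff lab π φ 0
  simp only [Nat.add_zero] at this
  rw [Set.mem_ofPred_eq, this, tr_piece, Set.mem_iUnion]
  constructor
  · rintro ⟨M, hM, i0, h⟩
    obtain ⟨k, hk⟩ := hf ⟨⟨M, hM⟩, i0⟩
    exact ⟨k, by rw [hk]; exact h⟩
  · rintro ⟨k, h⟩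
    exact ⟨_, (f k).1.2, _, h⟩

end ltl
end DV

namespace DV
open ATLs CGS

section game
variable {AP Ag Ac S : Type}

theorem trk_zero (π : ℕ → S) : trk π 0 = [π 0] := by simp [trk]

theorem trk_succ (π : ℕ → S) (i : ℕ) : trk π (i + 1) = trk π i ++ [π (i + 1)] := by
  simp only [trk]
  rw [List.ofFn_succ', List.concat_eq_append]
  simp

theorem trk_ne (π : ℕ → S) (i : ℕ) : trk π i ≠ [] := by simp [trk]

theorem trk_pre (π : ℕ → S) (i : ℕ) : trk π i = (pre π (i + 1)).reverse := by
  induction i with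
  | zero => simp [trk_zero, pre]
  | succ i ih => rw [trk_succ, ih, pre.eq_2 π (i + 1), List.reverse_cons]

theorem lst_trk (G : CGS AP Ag Ac S) (π : ℕ → S) (i : ℕ) : lst G (trk π i) = π i := by
  cases i with
  | zero => simp [trk_zero, lst]
  | succ i => rw [trk_succ]; simp [lst]

theorem exists_avail (G : CGS AP Ag Ac S) (A : Set Ag) (s : S) : ∃ dA : A → Ac, Avail G A s dA := by
  obtain ⟨d, hd⟩ := G.total s
  refine ⟨fun a => d a, d, ?_⟩
  have : combine A (fun a : A => d a) d = d := by
    funext a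
    simp [combine]
  rwa [this]

/-- successors under an `A`-decision -/
def outs (G : CGS AP Ag Ac S) (A : Set Ag) (s : S) (dA : A → Ac) : Set S :=
  {s' | ∃ d', G.tau s (combine A dA d') = some s'}

def forc (G : CGS AP Ag Ac S) (A : Set Ag) (s : S) : List S → Set (Set S)
  | [] => {{s}}
  | t :: _ => {D | ∃ dA, Avail G A t dA ∧ D = outs G A t dA}

theorem lst_rev (G : CGS AP Ag Ac S) (t : S) (q : List S) : lst G (t :: q).reverse = t := by
  simp [lst]

theorem determined (G : CGS AP Ag Ac S) (A : Set Ag) (s : S) [TopologicalSpace S]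
    [DiscreteTopology S] (W : Set (ℕ → S)) (hW : Sig3 W)
    (hno : ¬ ∃ f : List S → (A → Ac), StratOK G A f ∧ ∀ π, Outcome G A f s π → π ∈ W) :
    ∃ fc : List S → (A → Ac) → (Ag → Ac), CStratOK G A fc ∧
      ∀ π, COutcome G A fc s π → π ∉ W := by
  have hnw : ¬ IWin (forc G A s) Set.univ [] W := by
    rintro ⟨σ, -, h2, h3, h4⟩
    apply hno
    have hs : [s] ∈ σ := by
      obtain ⟨D, hD, hx⟩ := h3 [] h2
      obtain rfl : D = {s} := hD
      exact (hx s rfl (Set.mem_univ _)).resolve_right id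
    have hch : ∀ ν : List S, ∃ dA : A → Ac, Avail G A (lst G ν) dA ∧
        (ν ≠ [] → ν.reverse ∈ σ → ∀ x ∈ outs G A (lst G ν) dA, x :: ν.reverse ∈ σ) := by
      intro ν
      by_cases h : ν ≠ [] ∧ ν.reverse ∈ σ
      · obtain ⟨hne, hσ⟩ := h
        obtain ⟨D, hD, hx⟩ := h3 _ hσ
        cases hr : ν.reverse with
        | nil => simp at hr; exact absurd hr hne
        | cons t q =>
          have hl : lst G ν = t := by
            rw [← List.reverse_reverse ν, hr, lst_rev]
          rw [hr] at hD hx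
          obtain ⟨dA, hav, rfl⟩ := hD
          rw [hl]
          exact ⟨dA, hav, fun _ _ x hxD => (hx x hxD (Set.mem_univ _)).resolve_right id⟩
      · obtain ⟨dA, hd⟩ := exists_avail G A (lst G ν)
        exact ⟨dA, hd, fun a b => absurd ⟨a, b⟩ h⟩
    choose f hf1 hf2 using hch
    refine ⟨f, fun ν _ => hf1 ν, ?_⟩
    rintro π ⟨h0, hπ⟩
    have hin : ∀ n, pre π (n + 1) ∈ σ := by
      intro n
      induction n with
      | zero => simpa [pre, h0] using hs
      | succ n ih =>
        have h5 := hf2 (trk π n) (trk_ne π n)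
        rw [trk_pre, List.reverse_reverse, ← trk_pre, lst_trk] at h5
        exact h5 ih _ (hπ n)
    refine h4 π rfl fun n _ => ?_
    cases n with
    | zero => exact h2
    | succ n => exact hin n
  obtain ⟨U, hU, h0, hg⟩ := davis_top (forc G A s) W hW hnw
  have hs : [s] ∈ U := by
    obtain ⟨x, hx, hxU⟩ := hU [] h0 {s} rfl
    obtain rfl : x = s := hx
    exact hxU
  have hch : ∀ (ν : List S) (dA : A → Ac), ∃ d' : Ag → Ac, ν ≠ [] → Avail G A (lst G ν) dA →
      ((G.tau (lst G ν) (combine A dA d')).isSome ∧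
      (ν.reverse ∈ U → ∀ x, G.tau (lst G ν) (combine A dA d') = some x → x :: ν.reverse ∈ U)) := by
    intro ν dA
    by_cases hav : Avail G A (lst G ν) dA
    · by_cases h : ν ≠ [] ∧ ν.reverse ∈ U
      · obtain ⟨hne, hσ⟩ := h
        cases hr : ν.reverse with
        | nil => simp at hr; exact absurd hr hne
        | cons t q =>
          have hl : lst G ν = t := by
            rw [← List.reverse_reverse ν, hr, lst_rev]
          rw [hr] at hσ
          rw [hl] at hav ⊢
          obtain ⟨x, ⟨d', hd⟩, hxU⟩ := hU _ hσ (outs G A t dA) ⟨dA, hav, rfl⟩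
          refine ⟨d', fun _ _ => ⟨by rw [hd]; rfl, fun _ y hy => ?_⟩⟩
          rw [hd] at hy
          obtain rfl : x = y := by simpa using hy
          exact hxU
      · obtain ⟨d', hd⟩ := hav
        exact ⟨d', fun hne _ => ⟨hd, fun hu => absurd ⟨hne, hu⟩ h⟩⟩
    · have := exists_avail G A (lst G ν)
      obtain ⟨d, _⟩ := G.total (lst G ν)
      exact ⟨d, fun _ h => absurd h hav⟩
  choose fc hfc using hch
  refine ⟨fc, fun ν hν dA hav => (hfc ν dA hν hav).1, ?_⟩
  rintro π ⟨hπ0, hπ⟩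
  have hin : ∀ n, pre π (n + 1) ∈ U := by
    intro n
    induction n with
    | zero => simpa [pre, hπ0] using hs
    | succ n ih =>
      obtain ⟨dA, hav, ht⟩ := hπ n
      have h5 := hfc (trk π n) dA (trk_ne π n)
      rw [lst_trk] at h5
      have h6 := (h5 hav).2
      rw [trk_pre, List.reverse_reverse, ← trk_pre] at h6
      exact h6 ih _ ht
  refine hg π fun n => ?_
  cases n with
  | zero => exact h0
  | succ n => exact hin n

/-- plays from a track-dependent successor function -/
theorem exists_seq (s : S) (nx : List S → S) :
    ∃ π : ℕ → S, π 0 = s ∧ ∀ i, π (i + 1) = nx (trk π i) := by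
  let L : ℕ → List S := fun n => Nat.rec [s] (fun _ l => l ++ [nx l]) n
  have hL : ∀ n, L (n + 1) = L n ++ [nx (L n)] := fun _ => rfl
  let π : ℕ → S := fun n => (L n).getLastD s
  have h0 : π 0 = s := rfl
  have h1 : ∀ n, π (n + 1) = nx (L n) := by
    intro n
    simp only [π, hL]
    simp
  have ht : ∀ n, trk π n = L n := by
    intro n
    induction n with
    | zero => rw [trk_zero, h0]; rfl
    | succ n ih => rw [trk_succ, ih, h1, hL]
  exact ⟨π, h0, fun i => by rw [h1, ht]⟩

theorem clash (G : CGS AP Ag Ac S) (A : Set Ag) (s : S) (f : List S → (A → Ac))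
    (fc : List S → (A → Ac) → (Ag → Ac)) (hf : StratOK G A f) (hfc : CStratOK G A fc) :
    ∃ π, Outcome G A f s π ∧ COutcome G A fc s π := by
  have h : ∀ ν : List S, ∃ x, ν ≠ [] →
      G.tau (lst G ν) (combine A (f ν) (fc ν (f ν))) = some x := by
    intro ν
    by_cases hν : ν = []
    · exact ⟨s, fun h => absurd hν h⟩
    · obtain ⟨x, hx⟩ := Option.isSome_iff_exists.1 (hfc ν hν (f ν) (hf ν hν))
      exact ⟨x, fun _ => hx⟩
  choose nx hnx using h
  obtain ⟨π, h0, h1⟩ := exists_seq s nx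
  have h2 : ∀ i, G.tau (π i) (combine A (f (trk π i)) (fc (trk π i) (f (trk π i)))) =
      some (π (i + 1)) := by
    intro i
    have := hnx (trk π i) (trk_ne π i)
    rwa [lst_trk, ← h1] at this
  refine ⟨π, ⟨h0, fun i => ⟨_, h2 i⟩⟩, h0, fun i => ⟨f (trk π i), ?_, h2 i⟩⟩
  have := hf (trk π i) (trk_ne π i)
  rwa [lst_trk] at this

theorem exists_play (G : CGS AP Ag Ac S) (s : S) : ∃ π, IsPlay G π ∧ π 0 = s := by
  have h : ∀ t : S, ∃ x, Succ G t x := by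
    intro t
    obtain ⟨d, hd⟩ := G.total t
    obtain ⟨x, hx⟩ := Option.isSome_iff_exists.1 hd
    exact ⟨x, d, hx⟩
  choose nx hnx using h
  refine ⟨fun n => nx^[n] s, fun i => ?_, rfl⟩
  simp only [Function.iterate_succ_apply']
  exact hnx _

theorem state_ltl {Φ : ATLs AP Ag} (h : IsState Φ) (w w' : ℕ → Set (AP ⊕ ATLs AP Ag))
    (e : w 0 = w' 0) : ltlSat w Φ ↔ ltlSat w' Φ := by
  induction h with
  | tt => simp [ltlSat]
  | atom p => simp [ltlSat, e]
  | neg _ ih => simp [ltlSat, ih]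
  | or _ _ ih1 ih2 => simp [ltlSat, ih1, ih2]
  | coal A φ => simp [ltlSat, e]

/-- if labels are right, LTL truth is ATL* truth -/
theorem sat_iff (G : CGS AP Ag Ac S) (lab : S → Set (AP ⊕ ATLs AP Ag))
    (hl : ∀ s p, Sum.inl p ∈ lab s ↔ p ∈ G.lab s) (φ : ATLs AP Ag)
    (hc : ∀ A ψ, coal A ψ ∈ subf φ → (∀ π, sat G ψ π ↔ ltlSat (fun i => lab (π i)) ψ) →
      ∀ s, (Sum.inr (coal A ψ) ∈ lab s ↔ ∃ f : List S → (A → Ac), StratOK G A f ∧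
        ∀ π, Outcome G A f s π → sat G ψ π)) (π : ℕ → S) :
    sat G φ π ↔ ltlSat (fun i => lab (π i)) φ := by
  induction φ generalizing π with
  | tt => simp [sat, ltlSat]
  | atom p => simp [sat, ltlSat, hl]
  | neg φ ih => rw [sat, ltlSat, ih fun A ψ h => hc A ψ (Or.inr h)]
  | or φ ψ ih1 ih2 =>
    rw [sat, ltlSat, ih1 fun A ψ h => hc A ψ (Or.inr (Or.inl h)),
      ih2 fun A ψ h => hc A ψ (Or.inr (Or.inr h))]
  | next φ ih =>
    rw [sat, ltlSat, ih fun A ψ h => hc A ψ (Or.inr h)]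
    rfl
  | untl φ ψ ih1 ih2 =>
    simp only [sat, ltlSat, ih1 fun A ψ h => hc A ψ (Or.inr (Or.inl h)),
      ih2 fun A ψ h => hc A ψ (Or.inr (Or.inr h))]
    rfl
  | coal A φ ih =>
    rw [sat, ltlSat]
    exact (hc A φ (subf_self _) (ih fun A ψ h => hc A ψ (Or.inr h)) (π 0)).symm

end game
end DV

/-- a concurrent game tree `T` is a model of the ATL* state
formula `Φ` iff there is a `B_Φ`-labeling extension of `T` which is
well-formed with respect to `Φ`. -/
theorem model_iff_wellformed_extension {AP Ag Ac Υ : Type}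
    (T : CGT AP Ag Ac Υ) (Φ : ATLs AP Ag) (hΦ : ATLs.IsState Φ) :
    ATLs.models T.toCGS Φ ↔
      ∃ lab' : List Υ → Set (AP ⊕ ATLs AP Ag),
        CGT.IsLabExt T lab' ∧ CGT.WellFormed T lab' Φ := by
  constructor
  · rintro ⟨π, hπ, hπ0, hsat⟩
    let lab' : List Υ → Set (AP ⊕ ATLs AP Ag) := fun ν =>
      {y | (∃ p ∈ T.lab ν, y = Sum.inl p) ∨ ∃ (h : ν ∈ T.nodes) (A : Set Ag) (ψ : ATLs AP Ag),
        y = Sum.inr (ATLs.coal A ψ) ∧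
        ∃ f : List {x : List Υ // x ∈ T.nodes} → (A → Ac), CGS.StratOK T.toCGS A f ∧
          ∀ π, CGS.Outcome T.toCGS A f ⟨ν, h⟩ π → ATLs.sat T.toCGS ψ π}
    have hl : ∀ ν p, Sum.inl p ∈ lab' ν ↔ p ∈ T.lab ν := by
      intro ν p
      constructor
      · rintro (⟨q, hq, e⟩ | ⟨_, _, _, e, _⟩)
        · obtain rfl : p = q := by simpa using e
          exact hq
        · simp at e
      · intro h
        exact Or.inl ⟨p, h, rfl⟩
    have hc : ∀ A ψ (s : {x : List Υ // x ∈ T.nodes}), (Sum.inr (ATLs.coal A ψ) ∈ lab' s.1 ↔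
        ∃ f : List {x : List Υ // x ∈ T.nodes} → (A → Ac), CGS.StratOK T.toCGS A f ∧
        ∀ π, CGS.Outcome T.toCGS A f s π → ATLs.sat T.toCGS ψ π) := by
      intro A ψ s
      constructor
      · rintro (⟨q, hq, e⟩ | ⟨h, B, χ, e, hf⟩)
        · simp at e
        · simp only [Sum.inr.injEq, ATLs.coal.injEq] at e
          obtain ⟨rfl, rfl⟩ := e
          exact hf
      · intro h
        exact Or.inr ⟨s.2, A, ψ, rfl, h⟩
    have key : ∀ φ (π : ℕ → {x : List Υ // x ∈ T.nodes}),
        ATLs.sat T.toCGS φ π ↔ ATLs.ltlSat (fun i => lab' (π i).1) φ := fun φ π =>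
      DV.sat_iff T.toCGS (fun s => lab' s.1) (fun s p => hl s.1 p) φ (fun A ψ _ _ s => hc A ψ s) π
    refine ⟨lab', fun ν _ => by ext p; exact hl ν p, fun A ψ _ => ⟨?_, ?_⟩, ?_⟩
    · intro ν hν
      obtain ⟨f, hf, hf'⟩ := (hc A ψ ν).1 hν
      exact ⟨f, hf, fun π h => (key ψ π).1 (hf' π h)⟩
    · intro ν hν
      letI : TopologicalSpace {x : List Υ // x ∈ T.nodes} := ⊥
      haveI : DiscreteTopology {x : List Υ // x ∈ T.nodes} := ⟨rfl⟩
      refine DV.determined T.toCGS A ν _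
        (DV.ltl_sig3 (fun s : {x : List Υ // x ∈ T.nodes} => lab' s.1) ψ) ?_
      rintro ⟨f, hf, hf'⟩
      exact hν ((hc A ψ ν).2 ⟨f, hf, fun π h => (key ψ π).2 (hf' π h)⟩)
    · refine (DV.state_ltl hΦ _ _ ?_).1 ((key Φ π).1 hsat)
      simp only [hπ0]
      rfl
  · rintro ⟨lab', hext, hwf, hroot⟩
    have key := DV.sat_iff T.toCGS (fun s => lab' s.1)
      (fun s p => by rw [show T.toCGS.lab s = T.lab s.1 from rfl, ← hext s.1 s.2]; rfl) Φ
      (fun A ψ hsub ih s => by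
        obtain ⟨hp, hn⟩ := hwf A ψ ⟨hsub, A, ψ, rfl⟩
        constructor
        · intro h
          obtain ⟨f, hf, hf'⟩ := hp s h
          exact ⟨f, hf, fun π h => (ih π).2 (hf' π h)⟩
        · rintro ⟨f, hf, hf'⟩
          by_contra h
          obtain ⟨fc, hfc, hfc'⟩ := hn s h
          obtain ⟨π, h1, h2⟩ := DV.clash T.toCGS A s f fc hf hfc
          exact hfc' π h2 ((ih π).1 (hf' π h1)))
    obtain ⟨π, hπ, hπ0⟩ := DV.exists_play T.toCGS T.toCGS.init
    refine ⟨π, hπ, hπ0, (key π).2 ((DV.state_ltl hΦ _ _ ?_).1 hroot)⟩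
    simp only [hπ0]
    rfl
end
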